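/- arXiv:1211.2641 — 10 statements merged into one kernel-verified Lean document; each statement's English description precedes it below -/
import Mathlib

section
/- For every positive integer n, every good graph on n vertices has at most (n/2)·log₂(n) edges; equivalently, f(n) ≤ (n/2)·log₂(n). -/
/-- An edge-labelling `φ` of a simple graph `G` is *good* if for every ordered pair of
vertices `(u, v)` there is at most one path from `u` to `v` along which the edge labels
are nondecreasing. -/
def GoodLabelling {V : Type*} (G : SimpleGraph V) (φ : Sym2 V → ℝ) : Prop :=
  ∀ (u v : V) (p q : G.Walk u v), p.IsPath → q.IsPath →
    (p.edges.map φ).Chain' (· ≤ ·) → (q.edges.map φ).Chain' (· ≤ ·) → p = q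

/-- A graph is *good* if it admits a good edge-labelling. -/
def IsGoodGraph {V : Type*} (G : SimpleGraph V) : Prop :=
  ∃ φ : Sym2 V → ℝ, GoodLabelling G φ

namespace SimpleGraph

open scoped List

variable {V : Type*} {G : SimpleGraph V}

/-- The vertices `x` joined to `v` by a path whose edges, in order, form a sublist of `L`. -/
def sublistPathSources (G : SimpleGraph V) (L : List (Sym2 V)) (v : V) : Set V :=
  {x | ∃ p : G.Walk x v, p.IsPath ∧ p.edges <+ L}

theorem mem_sublistPathSources_self (L : List (Sym2 V)) (v : V) :
    v ∈ G.sublistPathSources L v :=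
  ⟨Walk.nil, Walk.IsPath.nil, by simp⟩

theorem sublistPathSources_mono {L L' : List (Sym2 V)} (h : L <+ L') (v : V) :
    G.sublistPathSources L v ⊆ G.sublistPathSources L' v := by
  rintro x ⟨p, hp, hpL⟩
  exact ⟨p, hp, hpL.trans h⟩

theorem Walk.edges_takeUntil_sublist [DecidableEq V] {x v u : V} (p : G.Walk x v)
    (hu : u ∈ p.support) : (p.takeUntil u hu).edges <+ p.edges := by
  conv_rhs => rw [← p.take_spec hu, Walk.edges_append]
  exact List.sublist_append_left _ _

theorem Walk.edges_concat_sublist {L : List (Sym2 V)} {x u v : V} {p : G.Walk x u}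
    (h : G.Adj u v) (hp : p.edges <+ L) : (p.concat h).edges <+ L ++ [s(u, v)] := by
  rw [Walk.edges_concat, List.concat_eq_append]
  exact hp.append (List.Sublist.refl _)

theorem sublistPathSources_subset_append {L : List (Sym2 V)} {u v : V} (h : G.Adj u v) :
    G.sublistPathSources L u ⊆ G.sublistPathSources (L ++ [s(u, v)]) v := by
  classical
  rintro x ⟨p, hp, hpL⟩
  by_cases hv : v ∈ p.support
  · exact ⟨p.takeUntil v hv, hp.takeUntil hv,
      ((p.edges_takeUntil_sublist hv).trans hpL).trans (List.sublist_append_left _ _)⟩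
  · exact ⟨p.concat h, hp.concat hv h, Walk.edges_concat_sublist h hpL⟩

/-- At most one path between any two vertices has edges forming a sublist of `L`. -/
def UniqueSublistPaths (G : SimpleGraph V) (L : List (Sym2 V)) : Prop :=
  ∀ (x y : V) (p q : G.Walk x y), p.IsPath → q.IsPath → p.edges <+ L → q.edges <+ L → p = q

theorem UniqueSublistPaths.mem_support {L : List (Sym2 V)} {u v x : V} (h : G.Adj u v)
    (hL : G.UniqueSublistPaths (L ++ [s(u, v)])) (huv : s(u, v) ∉ L)
    {p : G.Walk x u} (hp : p.IsPath) (hpL : p.edges <+ L)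
    {q : G.Walk x v} (hq : q.IsPath) (hqL : q.edges <+ L) : v ∈ p.support := by
  by_contra hv
  have heq := hL x v (p.concat h) q (hp.concat hv h) hq (Walk.edges_concat_sublist h hpL)
    (hqL.trans (List.sublist_append_left _ _))
  refine huv (hqL.subset ?_)
  rw [← heq, Walk.edges_concat]
  simp

theorem UniqueSublistPaths.disjoint {L : List (Sym2 V)} {u v : V} (h : G.Adj u v)
    (hL : G.UniqueSublistPaths (L ++ [s(u, v)])) (huv : s(u, v) ∉ L) :
    Disjoint (G.sublistPathSources L u) (G.sublistPathSources L v) := by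
  classical
  rw [Set.disjoint_left]
  rintro x ⟨p, hp, hpL⟩ ⟨q, hq, hqL⟩
  have hv : v ∈ p.support := hL.mem_support h huv hp hpL hq hqL
  have hu : u ∈ q.support := by
    rw [Sym2.eq_swap] at hL huv
    exact hL.mem_support h.symm huv hq hqL hp hpL
  have hsub : L <+ L ++ [s(u, v)] := List.sublist_append_left _ _
  have hp' := hL x u p (q.takeUntil u hu) hp (hq.takeUntil hu) (hpL.trans hsub)
    (((q.edges_takeUntil_sublist hu).trans hqL).trans hsub)
  have hq' := hL x v q (p.takeUntil v hv) hq (hp.takeUntil hv) (hqL.trans hsub)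
    (((p.edges_takeUntil_sublist hv).trans hpL).trans hsub)
  have h1 := p.length_takeUntil_lt_length hv h.ne'
  have h2 := q.length_takeUntil_le_length hu
  rw [← hq'] at h1
  rw [← hp'] at h2
  omega

theorem two_le_two_mul_logb_add_sub {a b : ℝ} (ha : 0 < a) (hb : 0 < b) :
    2 ≤ 2 * Real.logb 2 (a + b) - Real.logb 2 a - Real.logb 2 b := by
  have h4 : Real.logb 2 (2 ^ 2 * (a * b)) ≤ Real.logb 2 ((a + b) ^ 2) :=
    Real.logb_le_logb_of_le (by norm_num) (by positivity) (by nlinarith [sq_nonneg (a - b)])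
  rw [Real.logb_mul (by positivity) (by positivity), Real.logb_mul ha.ne' hb.ne',
    Real.logb_pow, Real.logb_pow, Real.logb_self_eq_one (by norm_num)] at h4
  push_cast at h4
  linarith

theorem UniqueSublistPaths.two_mul_length_le [Fintype V] {L : List (Sym2 V)}
    (hL : G.UniqueSublistPaths L) (hnd : L.Nodup) (hG : ∀ e ∈ L, e ∈ G.edgeSet) :
    2 * (L.length : ℝ) ≤ ∑ v, Real.logb 2 (G.sublistPathSources L v).ncard := by
  classical
  induction L using List.reverseRecOn with
  | nil =>
    simp only [List.length_nil, Nat.cast_zero, mul_zero]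
    refine Finset.sum_nonneg fun v _ => Real.logb_nonneg (by norm_num) ?_
    exact_mod_cast (Set.ncard_pos (Set.toFinite _)).2 ⟨v, mem_sublistPathSources_self _ v⟩
  | append_singleton L e ih =>
    induction e using Sym2.inductionOn with
    | hf u v =>
    have hsub : L <+ L ++ [s(u, v)] := List.sublist_append_left _ _
    have huv : G.Adj u v := hG s(u, v) (by simp)
    have hnot : s(u, v) ∉ L := fun hmem =>
      (List.nodup_append.1 hnd).2.2 _ hmem _ (by simp) rfl
    have ih' := ih (fun x y p q hp hq hpL hqL => hL x y p q hp hq (hpL.trans hsub)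
      (hqL.trans hsub)) (hnd.sublist hsub) fun e he => hG e (hsub.subset he)
    set c : V → ℝ := fun w => (G.sublistPathSources L w).ncard with hc
    set d : V → ℝ := fun w => (G.sublistPathSources (L ++ [s(u, v)]) w).ncard with hd
    have hpos : ∀ w, 0 < c w := fun w => by
      exact Nat.cast_pos.2 <| (Set.ncard_pos (Set.toFinite _)).2 ⟨w, mem_sublistPathSources_self _ w⟩
    have hmono : ∀ w, c w ≤ d w := fun w => by
      exact Nat.cast_le.2 <| Set.ncard_le_ncard (sublistPathSources_mono hsub w) (Set.toFinite _)
    have hunion : c u + c v = (G.sublistPathSources L u ∪ G.sublistPathSources L v).ncard := by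
      rw [Set.ncard_union_eq (hL.disjoint huv hnot) (Set.toFinite _) (Set.toFinite _)]
      simp [hc]
    have hu : c u + c v ≤ d u := by
      rw [hunion]
      refine Nat.cast_le.2 (Set.ncard_le_ncard (Set.union_subset
        (sublistPathSources_mono hsub u) ?_) (Set.toFinite _))
      rw [Sym2.eq_swap]
      exact sublistPathSources_subset_append huv.symm
    have hv : c u + c v ≤ d v := by
      rw [hunion]
      exact Nat.cast_le.2 (Set.ncard_le_ncard (Set.union_subset
        (sublistPathSources_subset_append huv) (sublistPathSources_mono hsub v)) (Set.toFinite _))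
    have hlog : ∀ {a b : ℝ}, 0 < a → a ≤ b → Real.logb 2 a ≤ Real.logb 2 b :=
      fun ha hab => Real.logb_le_logb_of_le (by norm_num) ha hab
    have hpair : ∑ w ∈ {u, v}, (Real.logb 2 (d w) - Real.logb 2 (c w)) ≤
        ∑ w, (Real.logb 2 (d w) - Real.logb 2 (c w)) :=
      Finset.sum_le_sum_of_subset_of_nonneg (Finset.subset_univ _) fun w _ _ =>
        sub_nonneg.2 (hlog (hpos w) (hmono w))
    rw [Finset.sum_pair huv.ne, Finset.sum_sub_distrib] at hpair
    have hcuv := add_pos (hpos u) (hpos v)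
    have h2 := two_le_two_mul_logb_add_sub (hpos u) (hpos v)
    have hdu := hlog hcuv hu
    have hdv := hlog hcuv hv
    rw [List.length_append, List.length_singleton]
    push_cast
    linarith

theorem UniqueSublistPaths.length_le [Fintype V] {L : List (Sym2 V)}
    (hL : G.UniqueSublistPaths L) (hnd : L.Nodup) (hG : ∀ e ∈ L, e ∈ G.edgeSet) :
    (L.length : ℝ) ≤ (Fintype.card V : ℝ) / 2 * Real.logb 2 (Fintype.card V) := by
  have hsum : ∑ v, Real.logb 2 (G.sublistPathSources L v).ncard ≤
      ∑ _v : V, Real.logb 2 (Fintype.card V) := by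
    refine Finset.sum_le_sum fun v _ => Real.logb_le_logb_of_le (by norm_num) ?_ ?_
    · exact_mod_cast (Set.ncard_pos (Set.toFinite _)).2 ⟨v, mem_sublistPathSources_self _ v⟩
    · rw [← Nat.card_eq_fintype_card]
      exact_mod_cast Set.ncard_le_card _
  have := hL.two_mul_length_le hnd hG
  rw [Finset.sum_const, Finset.card_univ, nsmul_eq_mul] at hsum
  linarith

end SimpleGraph

theorem GoodLabelling.uniqueSublistPaths {V : Type*} {G : SimpleGraph V} {φ : Sym2 V → ℝ}
    (hφ : GoodLabelling G φ) {L : List (Sym2 V)} (hL : L.Pairwise fun a b => φ a ≤ φ b) :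
    G.UniqueSublistPaths L := by
  intro x y p q hp hq hpL hqL
  exact hφ x y p q hp hq (List.pairwise_map.2 (hL.sublist hpL)).isChain
    (List.pairwise_map.2 (hL.sublist hqL)).isChain

/-- **Upper bound.** For every positive integer `n`, every good graph on `n` vertices has
at most `(n/2)·log₂ n` edges. -/
theorem goodGraph_card_edges_le (n : ℕ) (hn : 0 < n) (G : SimpleGraph (Fin n))
    (hG : IsGoodGraph G) :
    (G.edgeSet.ncard : ℝ) ≤ (n : ℝ) / 2 * Real.logb 2 (n : ℝ) := by
  classical
  obtain ⟨φ, hφ⟩ := hG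
  let r : Sym2 (Fin n) → Sym2 (Fin n) → Prop := fun a b => φ a ≤ φ b
  have : Std.Total r := ⟨fun a b => le_total (φ a) (φ b)⟩
  have : IsTrans _ r := ⟨fun _ _ _ => le_trans⟩
  have hperm := List.perm_insertionSort r G.edgeFinset.toList
  have hsorted := List.pairwise_insertionSort r G.edgeFinset.toList
  have hlen := (hφ.uniqueSublistPaths hsorted).length_le
    (hperm.nodup_iff.2 (Finset.nodup_toList _))
    fun e he => by simpa using hperm.mem_iff.1 he
  rw [hperm.length_eq, Finset.length_toList, Fintype.card_fin] at hlen
  rwa [← SimpleGraph.coe_edgeFinset, Set.ncard_coe_finset]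
end

section
/- For every positive integer n, there exists a good graph on n vertices with at least b(n) edges; equivalently, f(n) ≥ b(n). -/
/-- `binOnes n` is the total number of `1`s in the binary expansions of all
integers from `0` up to `n - 1`. -/
def binOnes (n : ℕ) : ℕ :=
  ∑ i ∈ Finset.range n, (Nat.digits 2 i).sum

namespace HypercubeSegment

/-- The XOR of the two endpoints of a pair of elements of `Fin n`. -/
def xorLabel {n : ℕ} : Sym2 (Fin n) → ℕ :=
  Sym2.lift ⟨fun a b => a.val ^^^ b.val, fun a b => Nat.xor_comm a.val b.val⟩

@[simp]
lemma xorLabel_mk {n : ℕ} (a b : Fin n) : xorLabel s(a, b) = a.val ^^^ b.val := rfl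

/-- The subgraph of the hypercube induced by the vertices `0, …, n - 1`: two vertices are
adjacent when their binary expansions differ in exactly one position. -/
def segmentGraph (n : ℕ) : SimpleGraph (Fin n) where
  Adj a b := ∃ k, a.val ^^^ b.val = 2 ^ k
  symm := ⟨fun a b ⟨k, hk⟩ => ⟨k, by rw [Nat.xor_comm, hk]⟩⟩
  loopless := ⟨fun a ⟨k, hk⟩ => (Nat.two_pow_pos k).ne (by rwa [Nat.xor_self] at hk)⟩

variable {n : ℕ} {u v w : Fin n}

lemma testBit_eq_iff_of_xor_eq_two_pow {a b k : ℕ} (h : a ^^^ b = 2 ^ k) (j : ℕ) :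
    a.testBit j = b.testBit j ↔ j ≠ k := by
  have hj := congrArg (Nat.testBit · j) h
  simp only [Nat.testBit_xor, Nat.testBit_two_pow] at hj
  rw [ne_comm, ne_eq, ← decide_eq_true_iff (p := k = j), ← hj]
  cases a.testBit j <;> cases b.testBit j <;> simp

/-- A walk that never uses direction `j` preserves the `j`-th bit. -/
lemma testBit_eq_of_walk (p : (segmentGraph n).Walk u v) (j : ℕ)
    (hp : ∀ e ∈ p.edges, xorLabel e ≠ 2 ^ j) : u.val.testBit j = v.val.testBit j := by
  induction p with
  | nil => rfl
  | cons h p ih =>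
    simp only [SimpleGraph.Walk.edges_cons, List.mem_cons, forall_eq_or_imp, xorLabel_mk] at hp
    obtain ⟨k, hk⟩ := h
    rw [← ih hp.2, testBit_eq_iff_of_xor_eq_two_pow hk]
    rintro rfl
    exact hp.1 hk

/-- The first label of a nondecreasing path is strictly smaller than all later ones. -/
lemma xorLabel_lt_of_mem_edges {h : (segmentGraph n).Adj u w}
    {p : (segmentGraph n).Walk w v} (hp : (SimpleGraph.Walk.cons h p).IsPath)
    (hc : ((SimpleGraph.Walk.cons h p).edges.map xorLabel).IsChain (· ≤ ·)) :
    ∀ e ∈ p.edges, u.val ^^^ w.val < xorLabel e := by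
  cases p with
  | nil => simp
  | @cons _ x _ h' p =>
    have hxu : x ≠ u := by
      rintro rfl
      simp [SimpleGraph.Walk.cons_isPath_iff] at hp
    have hne : u.val ^^^ w.val ≠ w.val ^^^ x.val := by
      intro he
      rw [Nat.xor_comm] at he
      exact hxu (Fin.ext (Nat.xor_right_injective he).symm)
    rw [List.isChain_iff_pairwise] at hc
    simp only [SimpleGraph.Walk.edges_cons, List.map_cons, List.pairwise_cons, List.mem_cons,
      List.mem_map, xorLabel_mk, forall_eq_or_imp, forall_exists_index, and_imp,
      forall_apply_eq_imp_iff₂] at hc ⊢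
    have hlt := lt_of_le_of_ne hc.1.1 hne
    exact ⟨hlt, fun e he => hlt.trans_le (hc.2.1 e he)⟩

/-- The direction of the first edge of a nondecreasing path is the lowest bit at which its
endpoints differ. -/
lemma testBit_eq_iff_of_isPath_cons {h : (segmentGraph n).Adj u w}
    {p : (segmentGraph n).Walk w v} (hp : (SimpleGraph.Walk.cons h p).IsPath)
    (hc : ((SimpleGraph.Walk.cons h p).edges.map xorLabel).IsChain (· ≤ ·))
    {k : ℕ} (hk : u.val ^^^ w.val = 2 ^ k) {j : ℕ} (hj : j ≤ k) :
    u.val.testBit j = v.val.testBit j ↔ j ≠ k := by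
  rw [← testBit_eq_of_walk p j, testBit_eq_iff_of_xor_eq_two_pow hk]
  intro e he heq
  have hlt := xorLabel_lt_of_mem_edges hp hc e he
  rw [heq, hk] at hlt
  exact hlt.not_ge (Nat.pow_le_pow_right two_pos hj)

lemma eq_of_isPath_of_isChain {u v : Fin n} (p q : (segmentGraph n).Walk u v)
    (hp : p.IsPath) (hq : q.IsPath) (hpc : (p.edges.map xorLabel).IsChain (· ≤ ·))
    (hqc : (q.edges.map xorLabel).IsChain (· ≤ ·)) : p = q := by
  induction p with
  | nil =>
    cases q with
    | nil => rfl
    | cons h q => simp at hq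
  | @cons a b c h p ih =>
    cases q with
    | nil => simp at hp
    | @cons _ d _ h' q =>
      obtain ⟨k, hk⟩ := id h
      obtain ⟨l, hl⟩ := id h'
      have hkl : k = l := by
        rcases lt_trichotomy k l with hlt | heq | hlt
        · exact absurd ((testBit_eq_iff_of_isPath_cons hq hqc hl hlt.le).mpr hlt.ne)
            (by simp [testBit_eq_iff_of_isPath_cons hp hpc hk le_rfl])
        · exact heq
        · exact absurd ((testBit_eq_iff_of_isPath_cons hp hpc hk hlt.le).mpr hlt.ne)
            (by simp [testBit_eq_iff_of_isPath_cons hq hqc hl le_rfl])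
      subst hkl
      obtain rfl : b = d := Fin.ext (Nat.xor_right_injective (hk.trans hl.symm))
      rw [ih q hp.of_cons hq.of_cons hpc.tail hqc.tail]

lemma isGoodGraph_segmentGraph (n : ℕ) : IsGoodGraph (segmentGraph n) := by
  refine ⟨fun e => (xorLabel e : ℝ), fun u v p q hp hq hpc hqc => ?_⟩
  have isChain_of_cast : ∀ l : List (Sym2 (Fin n)),
      (l.map fun e => (xorLabel e : ℝ)).IsChain (· ≤ ·) →
        (l.map xorLabel).IsChain (· ≤ ·) := by
    intro l hl
    simpa [List.isChain_map] using hl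
  exact eq_of_isPath_of_isChain p q hp hq (isChain_of_cast _ hpc) (isChain_of_cast _ hqc)

lemma digits_two_sum_eq_length_bitIndices (m : ℕ) :
    (Nat.digits 2 m).sum = m.bitIndices.length := by
  induction m using Nat.strong_induction_on with
  | _ m ih =>
    rcases Nat.eq_zero_or_pos m with rfl | hm
    · simp
    · rw [Nat.digits_def' one_lt_two hm, List.sum_cons, ih _ (Nat.div_lt_self hm one_lt_two)]
      obtain ⟨k, rfl | rfl⟩ := Nat.even_or_odd' m
      · simp
      · have hk : (2 * k + 1) / 2 = k := by omega
        rw [hk, Nat.bitIndices_two_mul_add_one, List.length_cons, List.length_map, add_comm]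
        simp [Nat.add_mod]

lemma xor_two_pow_lt {i k : ℕ} (h : i.testBit k) : i ^^^ 2 ^ k < i :=
  Nat.lt_of_testBit k (by simp [h]) h fun j hj => by simp [Nat.testBit_two_pow_of_ne hj.ne]

lemma binOnes_le_ncard_edgeSet (n : ℕ) : binOnes n ≤ (segmentGraph n).edgeSet.ncard := by
  classical
  have hcard : binOnes n =
      (Finset.univ.sigma fun i : Fin n => i.val.bitIndices.toFinset).card := by
    rw [Finset.card_sigma, binOnes, Finset.sum_range]
    refine Finset.sum_congr rfl fun i _ => ?_
    rw [List.toFinset_card_of_nodup Nat.bitIndices_nodup, digits_two_sum_eq_length_bitIndices]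
  have hlt (x : Σ _ : Fin n, ℕ)
      (hx : x ∈ Finset.univ.sigma fun i : Fin n => i.val.bitIndices.toFinset) :
      x.1.val ^^^ 2 ^ x.2 < x.1.val := by
    simp only [Finset.mem_sigma, List.mem_toFinset, Nat.mem_bitIndices] at hx
    exact xor_two_pow_lt hx.2
  rw [hcard, Set.ncard_eq_toFinset_card']
  refine Finset.card_le_card_of_forall_subsingleton
    (fun x e => ∃ b : Fin n, b.val = x.1.val ^^^ 2 ^ x.2 ∧ e = s(x.1, b)) ?_ ?_
  · intro x hx
    refine ⟨s(x.1, ⟨_, (hlt x hx).trans x.1.isLt⟩), ?_, _, rfl, rfl⟩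
    rw [Set.mem_toFinset, SimpleGraph.mem_edgeSet]
    exact ⟨x.2, Nat.xor_xor_cancel_left _ _⟩
  · rintro e - ⟨i, k⟩ ⟨hi, b, hb, rfl⟩ ⟨j, l⟩ ⟨hj, c, hc, he⟩
    have hbi := hlt _ hi
    have hcj := hlt _ hj
    simp only at hb hc hbi hcj he
    rw [← hb] at hbi
    rw [← hc] at hcj
    rcases Sym2.eq_iff.mp he with ⟨rfl, rfl⟩ | ⟨rfl, rfl⟩
    · obtain rfl := Nat.pow_right_injective le_rfl (Nat.xor_right_injective (hb.symm.trans hc))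
      rfl
    · exact absurd hbi hcj.not_gt

end HypercubeSegment

/-- **Lower bound.** For every positive integer `n` there is a good graph on `n` vertices
with at least `b(n)` edges, where `b(n)` is the total number of `1`s in the binary
expansions of `0, 1, …, n-1`. -/
theorem exists_good_graph_binOnes_le (n : ℕ) (hn : 0 < n) :
    ∃ G : SimpleGraph (Fin n), IsGoodGraph G ∧ binOnes n ≤ G.edgeSet.ncard := by
  exact ⟨HypercubeSegment.segmentGraph n, HypercubeSegment.isGoodGraph_segmentGraph n,
    HypercubeSegment.binOnes_le_ncard_edgeSet n⟩
end

section
/- For every positive integer n, b(n) ≥ (n/2)·log₂(3n/4). -/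
theorem Nat.sum_digits_two_eq (n : ℕ) :
    (Nat.digits 2 n).sum = n % 2 + (Nat.digits 2 (n / 2)).sum := by
  rcases Nat.eq_zero_or_pos n with rfl | hn
  · simp
  · rw [Nat.digits_def' one_lt_two hn, List.sum_cons]

theorem Nat.sum_digits_two_pow_add (k i : ℕ) (hi : i < 2 ^ k) :
    (Nat.digits 2 (2 ^ k + i)).sum = 1 + (Nat.digits 2 i).sum := by
  induction k generalizing i with
  | zero =>
    obtain rfl : i = 0 := by simpa using hi
    simp
  | succ k ih =>
    rw [pow_succ] at hi ⊢
    rw [Nat.sum_digits_two_eq, Nat.sum_digits_two_eq i,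
      show (2 ^ k * 2 + i) / 2 = 2 ^ k + i / 2 by lia, ih _ (by lia)]
    lia

theorem binOnes_two_pow_add (k r : ℕ) (hr : r ≤ 2 ^ k) :
    binOnes (2 ^ k + r) = binOnes (2 ^ k) + r + binOnes r := by
  unfold binOnes
  rw [Finset.sum_range_add, add_assoc, Finset.sum_congr rfl fun i hi ↦
    Nat.sum_digits_two_pow_add k i ((Finset.mem_range.mp hi).trans_le hr)]
  simp [Finset.sum_add_distrib]

theorem two_mul_binOnes_two_pow (k : ℕ) : 2 * binOnes (2 ^ k) = k * 2 ^ k := by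
  induction k with
  | zero => simp [binOnes]
  | succ k ih =>
    rw [pow_succ, mul_two, binOnes_two_pow_add k _ le_rfl]
    linear_combination 2 * ih

theorem Real.sub_le_mul_log_sub_log {x y : ℝ} (hx : 0 ≤ x) (hy : 0 < y) :
    x - y ≤ x * (Real.log x - Real.log y) := by
  rcases hx.eq_or_lt with rfl | hx
  · simpa using hy.le
  · have h := mul_le_mul_of_nonneg_left (Real.log_le_sub_one_of_pos (div_pos hy hx)) hx.le
    rw [Real.log_div hy.ne' hx.ne', mul_sub, mul_sub, mul_one, mul_div_cancel₀ _ hx.ne'] at h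
    linarith

theorem mul_logb_add_le {a r : ℝ} (ha : 0 < a) (hr : 0 ≤ r) :
    (a + r) / 2 * Real.logb 2 (3 * (a + r) / 4) ≤
      a / 2 * Real.logb 2 a + r + r / 2 * Real.logb 2 (3 * r / 4) := by
  have hc : 0 < 3 * (a + r) / 4 := by positivity
  have h₁ := Real.sub_le_mul_log_sub_log ha.le hc
  have h₂ := Real.sub_le_mul_log_sub_log (x := 3 * r) (by positivity) hc
  have hlog : 0 < Real.log 2 := Real.log_pos one_lt_two
  have h₃ : r * Real.log (3 * r / 4) = r * (Real.log (3 * r) - 2 * Real.log 2) := by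
    rcases hr.eq_or_lt with rfl | hr
    · simp
    · rw [Real.log_div (by positivity) (by norm_num), show (4 : ℝ) = 2 ^ 2 by norm_num,
        Real.log_pow, Nat.cast_ofNat]
  simp only [Real.logb]
  rw [← mul_le_mul_iff_left₀ hlog]
  generalize Real.log (3 * (a + r) / 4) = u at *
  generalize Real.log (3 * r / 4) = v at *
  field_simp
  linarith

/-- For every positive integer `n`, `b(n) ≥ (n/2)·log₂(3n/4)`, where `b(n)` is the total
number of `1`s in the binary expansions of `0, 1, …, n-1`. -/
theorem binOnes_lower_bound (n : ℕ) (hn : 0 < n) :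
    (n : ℝ) / 2 * Real.logb 2 (3 * (n : ℝ) / 4) ≤ (binOnes n : ℝ) := by
  induction n using Nat.strong_induction_on with
  | _ n ih =>
    obtain ⟨r, hr⟩ := Nat.exists_eq_add_of_le (Nat.pow_log_le_self 2 hn.ne')
    have hlt := Nat.lt_pow_succ_log_self one_lt_two n
    generalize Nat.log 2 n = k at hr hlt
    subst hr
    have hpos : 0 < 2 ^ k := by positivity
    have hrec : (r : ℝ) / 2 * Real.logb 2 (3 * (r : ℝ) / 4) ≤ (binOnes r : ℝ) := by
      rcases Nat.eq_zero_or_pos r with rfl | h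
      · simp
      · exact ih r (by lia) h
    have hpow : (2 : ℝ) * binOnes (2 ^ k) = k * 2 ^ k := mod_cast two_mul_binOnes_two_pow k
    have hstep := mul_logb_add_le (a := 2 ^ k) (by positivity) r.cast_nonneg
    rw [Real.logb_pow, Real.logb_self_eq_one one_lt_two] at hstep
    rw [binOnes_two_pow_add k r (by rw [pow_succ] at hlt; lia)]
    push_cast
    linarith
end

section
/- f(1) = 0, and for every integer n > 1 and all positive integers n₁, n₂ with n₁ + n₂ = n, we have f(n) ≥ f(n₁) + f(n₂) + min{n₁, n₂}. -/
/-- `goodMax n` is the maximum number of edges of a good graph on `n` vertices. -/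
noncomputable def goodMax (n : ℕ) : ℕ :=
  sSup {m : ℕ | ∃ G : SimpleGraph (Fin n), IsGoodGraph G ∧ G.edgeSet.ncard = m}

namespace GoodLabelling

/-- A good labelling of a graph pulls back along an injective homomorphism. -/
theorem comap {V W : Type*} {G : SimpleGraph V} {G' : SimpleGraph W} {φ : Sym2 W → ℝ}
    (hφ : GoodLabelling G' φ) (f : G →g G') (hf : Function.Injective f) :
    GoodLabelling G (φ ∘ Sym2.map f) := by
  intro u v p q hp hq hpc hqc
  apply SimpleGraph.Walk.map_injective_of_injective hf u v
  apply hφ _ _ _ _ (hp.map hf) (hq.map hf)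
  · simpa using hpc
  · simpa using hqc

/-- A labelling depends only on its values on the edges of the graph. -/
theorem congr {V : Type*} {G : SimpleGraph V} {φ ψ : Sym2 V → ℝ} (hφ : GoodLabelling G φ)
    (h : ∀ e ∈ G.edgeSet, ψ e = φ e) : GoodLabelling G ψ := by
  have key {u v : V} (p : G.Walk u v) : p.edges.map ψ = p.edges.map φ :=
    List.map_congr_left fun e he ↦ h e (p.edges_subset_edgeSet he)
  intro u v p q hp hq hpc hqc
  rw [key] at hpc hqc
  exact hφ u v p q hp hq hpc hqc

end GoodLabelling

/-- If the image of a graph embedding is closed under adjacency, every walk starting in the image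
is the image of a walk. -/
theorem SimpleGraph.Walk.exists_map_copy_eq {V W : Type*} {G : SimpleGraph V} {G' : SimpleGraph W}
    (f : G ↪g G') (hf : ∀ u b, G'.Adj (f u) b → ∃ v, f v = b) {a b : W} (p : G'.Walk a b)
    {u : V} (hu : f u = a) :
    ∃ (v : V) (hv : f v = b) (q : G.Walk u v), (q.map f.toHom).copy hu hv = p := by
  induction p generalizing u with
  | nil => exact ⟨u, hu, .nil, by subst hu; rfl⟩
  | cons h p ih =>
    subst hu
    obtain ⟨w, rfl⟩ := hf _ _ h
    obtain ⟨v, rfl, q, rfl⟩ := ih rfl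
    exact ⟨v, rfl, .cons (f.map_adj_iff.1 h) q, rfl⟩

/-- A labelling pulling back to a good labelling of an adjacency-closed piece has at most one
nondecreasing path between any two vertices of that piece. -/
theorem GoodLabelling.eq_of_comap {V W : Type*} {G : SimpleGraph V} {G' : SimpleGraph W}
    {φ : Sym2 W → ℝ} (f : G ↪g G') (hf : ∀ u b, G'.Adj (f u) b → ∃ v, f v = b)
    (hφ : GoodLabelling G (φ ∘ Sym2.map f)) {u : V} {b : W} (p q : G'.Walk (f u) b)
    (hp : p.IsPath) (hq : q.IsPath) (hpc : (p.edges.map φ).IsChain (· ≤ ·))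
    (hqc : (q.edges.map φ).IsChain (· ≤ ·)) : p = q := by
  obtain ⟨v, rfl, p, rfl⟩ := p.exists_map_copy_eq f hf rfl
  obtain ⟨v', hv, q, rfl⟩ := q.exists_map_copy_eq f hf rfl
  obtain rfl := f.injective hv
  simp only [SimpleGraph.Walk.copy_rfl_rfl, SimpleGraph.Walk.edges_map, List.map_map] at *
  rw [hφ u _ p q hp.of_map hq.of_map hpc hqc]

/-- A labelling of a disjoint sum is good when both of its restrictions are. -/
theorem GoodLabelling.sum {V W : Type*} {G : SimpleGraph V} {H : SimpleGraph W}
    {φ : Sym2 (V ⊕ W) → ℝ} (hG : GoodLabelling G (φ ∘ Sym2.map Sum.inl))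
    (hH : GoodLabelling H (φ ∘ Sym2.map Sum.inr)) : GoodLabelling (G ⊕g H) φ := by
  rintro (u | u) b p q hp hq hpc hqc
  · refine GoodLabelling.eq_of_comap SimpleGraph.Embedding.sumInl ?_ hG p q hp hq hpc hqc
    rintro u (v | v) h
    · exact ⟨v, rfl⟩
    · simp at h
  · refine GoodLabelling.eq_of_comap SimpleGraph.Embedding.sumInr ?_ hH p q hp hq hpc hqc
    rintro u (v | v) h
    · simp at h
    · exact ⟨v, rfl⟩

theorem IsGoodGraph.sum {V W : Type*} {G : SimpleGraph V} {H : SimpleGraph W}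
    (hG : IsGoodGraph G) (hH : IsGoodGraph H) : IsGoodGraph (G ⊕g H) := by
  obtain ⟨φ, hφ⟩ := hG
  obtain ⟨ψ, hψ⟩ := hH
  refine ⟨Function.extend (Sym2.map Sum.inl) φ (Function.extend (Sym2.map Sum.inr) ψ 0), .sum ?_ ?_⟩
  · rwa [Function.extend_comp (Sym2.map.injective Sum.inl_injective)]
  · convert hψ using 1
    ext e
    rw [Function.comp_apply, Function.extend_apply',
      (Sym2.map.injective Sum.inr_injective).extend_apply]
    rintro ⟨e', h⟩
    induction e
    induction e'
    simp at h

theorem IsGoodGraph.comap {V W : Type*} {G : SimpleGraph V} {G' : SimpleGraph W}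
    (h : IsGoodGraph G') (f : G →g G') (hf : Function.Injective f) : IsGoodGraph G :=
  let ⟨_, hφ⟩ := h
  ⟨_, hφ.comap f hf⟩

theorem isGoodGraph_bot (V : Type*) : IsGoodGraph (⊥ : SimpleGraph V) := by
  refine ⟨0, ?_⟩
  rintro u v (_ | ⟨⟨⟩, _⟩) (_ | ⟨⟨⟩, _⟩) - - - -
  rfl

/-- If the edges of a matching `M` have a label exceeding all labels on `H`, a nondecreasing path of
`H ⊔ M` uses at most one edge of `M`, and uses it last. -/
theorem SimpleGraph.Walk.exists_mapLe_or_concat {V : Type*} {H M : SimpleGraph V} {φ : Sym2 V → ℝ}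
    {K : ℝ} (hH : ∀ e ∈ H.edgeSet, φ e < K) (hM : ∀ e ∈ M.edgeSet, φ e = K)
    (hmatch : ∀ a b c, M.Adj a b → M.Adj c b → a = c) {u v : V} (p : (H ⊔ M).Walk u v)
    (hp : p.IsPath) (hpc : (p.edges.map φ).IsChain (· ≤ ·)) :
    (∃ q : H.Walk u v, q.mapLe le_sup_left = p) ∨
      ∃ (w : V) (q : H.Walk u w) (h : M.Adj w v),
        (q.mapLe le_sup_left).concat (Or.inr h) = p := by
  induction p with
  | nil => exact .inl ⟨.nil, rfl⟩
  | @cons u w v h p ih =>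
    have ih := ih hp.of_cons (List.IsChain.tail hpc)
    obtain h | h := h
    · rcases ih with ⟨q, rfl⟩ | ⟨x, q, hx, rfl⟩
      · exact .inl ⟨.cons h q, rfl⟩
      · exact .inr ⟨x, .cons h q, hx, rfl⟩
    · cases p with
      | nil => exact .inr ⟨u, .nil, h, rfl⟩
      | @cons _ x _ h' p =>
        exfalso
        have hle : φ s(u, w) ≤ φ s(w, x) := (List.isChain_cons_cons.1 hpc).1
        rw [hM s(u, w) h] at hle
        obtain h' | h' := h'
        · exact (hH s(w, x) h').not_ge hle
        · obtain rfl := hmatch _ _ _ h h'.symm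
          simp at hp

/-- Joining the two sides of a bipartition, between which `H` has no edges, by a matching preserves
goodness. -/
theorem IsGoodGraph.sup_matching {V : Type*} [Finite V] {H M : SimpleGraph V} (c : V → Bool)
    (hc : ∀ a b, H.Adj a b → c a = c b) (hM : ∀ a b, M.Adj a b → c a ≠ c b)
    (hmatch : ∀ a b d, M.Adj a b → M.Adj d b → a = d) (hH : IsGoodGraph H) :
    IsGoodGraph (H ⊔ M) := by
  classical
  obtain ⟨φ, hφ⟩ := hH
  obtain ⟨B, hB⟩ := (Set.finite_range φ).bddAbove
  have hHM {e : Sym2 V} (he : e ∈ H.edgeSet) : e ∉ M.edgeSet := by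
    induction e with | _ a b => exact fun h ↦ hM a b h (hc a b he)
  have hwalk {u v : V} (p : H.Walk u v) : c u = c v := by
    induction p with
    | nil => rfl
    | cons h p ih => exact (hc _ _ h).trans ih
  set ψ : Sym2 V → ℝ := fun e ↦ if e ∈ M.edgeSet then B + 1 else φ e with hψdef
  have hψ : GoodLabelling H ψ := hφ.congr fun e he ↦ if_neg (hHM he)
  have hHψ : ∀ e ∈ H.edgeSet, ψ e < B + 1 := fun e he ↦ by
    rw [hψdef]
    simp only [if_neg (hHM he)]
    exact (hB ⟨e, rfl⟩).trans_lt (lt_add_one B)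
  have hMψ : ∀ e ∈ M.edgeSet, ψ e = B + 1 := fun e he ↦ if_pos he
  refine ⟨ψ, fun u v p q hp hq hpc hqc ↦ ?_⟩
  rcases p.exists_mapLe_or_concat hHψ hMψ hmatch hp hpc with ⟨p, rfl⟩ | ⟨x, p, hx, rfl⟩ <;>
    rcases q.exists_mapLe_or_concat hHψ hMψ hmatch hq hqc with ⟨q, rfl⟩ | ⟨y, q, hy, rfl⟩
  · rw [hψ u v p q hp.of_mapLe hq.of_mapLe (by simpa using hpc) (by simpa using hqc)]
  · exact (hM y v hy ((hwalk q).symm.trans (hwalk p))).elim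
  · exact (hM x v hx ((hwalk p).symm.trans (hwalk q))).elim
  · obtain rfl := hmatch _ _ _ hx hy
    rw [SimpleGraph.Walk.concat_isPath_iff] at hp hq
    simp only [SimpleGraph.Walk.edges_concat, List.concat_eq_append, List.map_append] at hpc hqc
    replace hpc := List.IsChain.left_of_append hpc
    replace hqc := List.IsChain.left_of_append hqc
    rw [SimpleGraph.Walk.edges_mapLe_eq_edges] at hpc hqc
    rw [hψ u x p q hp.1.of_mapLe hq.1.of_mapLe hpc hqc]

/-- The matching of `Fin m ⊕ Fin n` that joins equal numbers. -/
def SimpleGraph.finSumMatching (m n : ℕ) : SimpleGraph (Fin m ⊕ Fin n) where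
  Adj a b := a.isLeft ≠ b.isLeft ∧ a.elim Fin.val Fin.val = b.elim Fin.val Fin.val
  symm := ⟨fun _ _ h ↦ ⟨h.1.symm, h.2.symm⟩⟩
  loopless := ⟨fun _ h ↦ h.1 rfl⟩

theorem SimpleGraph.finSumMatching_unique {m n : ℕ} {a b d : Fin m ⊕ Fin n}
    (h : (finSumMatching m n).Adj a b) (h' : (finSumMatching m n).Adj d b) : a = d := by
  rcases a with a | a <;> rcases b with b | b <;> rcases d with d | d <;>
    simp_all [finSumMatching, Fin.ext_iff]

theorem SimpleGraph.min_le_ncard_edgeSet_finSumMatching (m n : ℕ) :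
    min m n ≤ (finSumMatching m n).edgeSet.ncard := by
  let f (i : Fin (min m n)) : Sym2 (Fin m ⊕ Fin n) :=
    s(.inl (i.castLE (min_le_left m n)), .inr (i.castLE (min_le_right m n)))
  have hf : Function.Injective f := fun i j h ↦ by simpa [f, Fin.ext_iff] using h
  calc min m n = (Set.range f).ncard := by
        rw [← Set.image_univ, Set.ncard_image_of_injective _ hf, Set.ncard_univ, Nat.card_fin]
    _ ≤ _ := Set.ncard_le_ncard (by rintro _ ⟨i, rfl⟩; simp [f, finSumMatching])

theorem bddAbove_goodMax_set (n : ℕ) :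
    BddAbove {m : ℕ | ∃ G : SimpleGraph (Fin n), IsGoodGraph G ∧ G.edgeSet.ncard = m} := by
  refine ⟨Nat.card (Sym2 (Fin n)), ?_⟩
  rintro _ ⟨G, -, rfl⟩
  exact Set.ncard_le_card _

theorem exists_ncard_edgeSet_eq_goodMax (n : ℕ) :
    ∃ G : SimpleGraph (Fin n), IsGoodGraph G ∧ G.edgeSet.ncard = goodMax n :=
  Nat.sSup_mem (s := {m : ℕ | ∃ G : SimpleGraph (Fin n), IsGoodGraph G ∧ G.edgeSet.ncard = m})
    ⟨_, ⊥, isGoodGraph_bot _, rfl⟩ (bddAbove_goodMax_set n)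

theorem IsGoodGraph.ncard_edgeSet_le_goodMax {V : Type*} {n : ℕ} {G : SimpleGraph V}
    (hG : IsGoodGraph G) (e : V ≃ Fin n) : G.edgeSet.ncard ≤ goodMax n := by
  have i := SimpleGraph.Iso.map e G
  refine le_csSup (bddAbove_goodMax_set n)
    ⟨_, hG.comap i.symm.toHom i.symm.injective, ?_⟩
  exact (Nat.card_congr i.mapEdgeSet).symm

/-- `f(1) = 0`, and for every `n > 1` and all positive `n₁, n₂` with `n₁ + n₂ = n`,
`f(n) ≥ f(n₁) + f(n₂) + min(n₁, n₂)`, where `f` is the maximum number of edges of a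
good graph on a given number of vertices. -/
theorem goodMax_recursive_bound :
    goodMax 1 = 0 ∧
      ∀ n n₁ n₂ : ℕ, 1 < n → 0 < n₁ → 0 < n₂ → n₁ + n₂ = n →
        goodMax n₁ + goodMax n₂ + min n₁ n₂ ≤ goodMax n := by
  constructor
  · obtain ⟨G, -, hG⟩ := exists_ncard_edgeSet_eq_goodMax 1
    rw [← hG, Subsingleton.elim G ⊥, SimpleGraph.edgeSet_bot, Set.ncard_empty]
  · rintro n m k - - - rfl
    obtain ⟨G, hG, hGm⟩ := exists_ncard_edgeSet_eq_goodMax m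
    obtain ⟨H, hH, hHk⟩ := exists_ncard_edgeSet_eq_goodMax k
    have hc (a b : Fin m ⊕ Fin k) (h : (G ⊕g H).Adj a b) : a.isLeft = b.isLeft := by
      rcases a with a | a <;> rcases b with b | b <;> simp_all
    have hgood := (hG.sum hH).sup_matching (M := .finSumMatching m k) Sum.isLeft hc
      (fun _ _ h ↦ h.1) (fun _ _ _ ↦ SimpleGraph.finSumMatching_unique)
    have hdisj : Disjoint (G ⊕g H).edgeSet (SimpleGraph.finSumMatching m k).edgeSet := by
      rw [Set.disjoint_left]
      intro e
      induction e with | _ a b => exact fun h h' ↦ h'.1 (hc a b h)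
    have hsum : (G ⊕g H).edgeSet.ncard = G.edgeSet.ncard + H.edgeSet.ncard := by
      simp only [← Nat.card_coe_set_eq]
      rw [← Nat.card_sum]
      exact Nat.card_congr SimpleGraph.edgeSetSumEquiv
    calc goodMax m + goodMax k + min m k
        ≤ (G ⊕g H).edgeSet.ncard + (SimpleGraph.finSumMatching m k).edgeSet.ncard := by
          rw [hsum, hGm, hHk]
          gcongr
          exact SimpleGraph.min_le_ncard_edgeSet_finSumMatching m k
      _ = ((G ⊕g H) ⊔ SimpleGraph.finSumMatching m k).edgeSet.ncard := by
          rw [SimpleGraph.edgeSet_sup, Set.ncard_union_eq hdisj]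
      _ ≤ goodMax (m + k) := hgood.ncard_edgeSet_le_goodMax finSumFinEquiv
end

section
/- For any starting configuration S and any nonnegative integer k, if starting from S one performs k moves where each move combines two smallest elements of the current configuration (the greedy strategy), then the sum of the resulting configuration equals opt(S,k). -/
/-- One move of the game: choose two elements `a` and `b` of the current configuration
(counted with multiplicity) and replace both of them by `a + b`. -/
def GameMove (S T : Multiset ℕ) : Prop :=
  ∃ (a b : ℕ) (S' : Multiset ℕ),
    S = a ::ₘ b ::ₘ S' ∧ T = (a + b) ::ₘ (a + b) ::ₘ S'

/-- `ReachIn k S T` means the configuration `T` can be obtained from `S` by exactly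
`k` moves of the game. -/
def ReachIn : ℕ → Multiset ℕ → Multiset ℕ → Prop
  | 0 => fun S T => T = S
  | k + 1 => fun S T => ∃ U : Multiset ℕ, GameMove S U ∧ ReachIn k U T

/-- `opt S k` is the smallest possible sum of a configuration obtainable from the
starting configuration `S` after exactly `k` moves. -/
noncomputable def opt (S : Multiset ℕ) (k : ℕ) : ℕ :=
  sInf {s : ℕ | ∃ T : Multiset ℕ, ReachIn k S T ∧ T.sum = s}

/-- A *greedy* move: combine two smallest elements of the current configuration. -/
def GreedyMove (S T : Multiset ℕ) : Prop :=
  ∃ (a b : ℕ) (S' : Multiset ℕ),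
    S = a ::ₘ b ::ₘ S' ∧ (∀ x ∈ S', a ≤ x) ∧ (∀ x ∈ S', b ≤ x) ∧
      T = (a + b) ::ₘ (a + b) ::ₘ S'

/-- `GreedyReachIn k S T` means `T` is obtained from `S` by exactly `k` greedy moves. -/
def GreedyReachIn : ℕ → Multiset ℕ → Multiset ℕ → Prop
  | 0 => fun S T => T = S
  | k + 1 => fun S T => ∃ U : Multiset ℕ, GreedyMove S U ∧ GreedyReachIn k U T

theorem ReachIn.succ {k : ℕ} {a b : ℕ} {R T : Multiset ℕ}
    (h : ReachIn k ((a + b) ::ₘ (a + b) ::ₘ R) T) : ReachIn (k + 1) (a ::ₘ b ::ₘ R) T :=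
  ⟨_, ⟨a, b, R, rfl, rfl⟩, h⟩

/-- A sequence of moves can be performed symbolically: the final sum is a fixed element `s` of
the monoid of symbolic values, and the same moves are available under every other evaluation. -/
theorem ReachIn.exists_symbolic_sum {A : Type*} [AddCommMonoid A] (φ : A →+ ℕ) (k : ℕ) :
    ∀ (M : Multiset A) (U : Multiset ℕ), ReachIn k (M.map φ) U →
      ∃ s : A, φ s = U.sum ∧ ∀ ψ : A →+ ℕ, ∃ U', ReachIn k (M.map ψ) U' ∧ U'.sum = ψ s := by
  classical
  induction k with
  | zero =>
    rintro M U rfl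
    exact ⟨M.sum, map_multiset_sum φ M, fun ψ => ⟨_, rfl, (map_multiset_sum ψ M).symm⟩⟩
  | succ k ih =>
    rintro M U ⟨V, ⟨a, b, S', hS, rfl⟩, hV⟩
    obtain ⟨α, hα, rfl, hM⟩ := (Multiset.map_eq_cons _ _ _ _).2 hS
    obtain ⟨N, rfl⟩ := Multiset.exists_cons_of_mem hα
    rw [Multiset.erase_cons_head] at hM
    obtain ⟨β, hβ, rfl, hN⟩ := (Multiset.map_eq_cons _ _ _ _).2 hM
    obtain ⟨N, rfl⟩ := Multiset.exists_cons_of_mem hβ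
    rw [Multiset.erase_cons_head] at hN
    subst hN
    obtain ⟨s, hs, h⟩ := ih ((α + β) ::ₘ (α + β) ::ₘ N) U (by simpa using hV)
    refine ⟨s, hs, fun ψ => ?_⟩
    obtain ⟨U', hU', hsum⟩ := h ψ
    refine ⟨U', ?_, hsum⟩
    simp only [Multiset.map_cons, map_add] at hU' ⊢
    exact hU'.succ

/-- Replacing two elements by a weakly more spread out pair does not increase the sums that
can be reached. -/
theorem ReachIn.exists_sum_le_of_spread {k x y x' y' : ℕ} {R U : Multiset ℕ}
    (h : ReachIn k (x ::ₘ y ::ₘ R) U) (hx : x' ≤ x) (hy : x' ≤ y) (hxy : x' + y' ≤ x + y) :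
    ∃ U', ReachIn k (x' ::ₘ y' ::ₘ R) U' ∧ U'.sum ≤ U.sum := by
  let ev (u v : ℕ) : ℕ × ℕ × ℕ →+ ℕ :=
    { toFun := fun t => t.1 * u + t.2.1 * v + t.2.2
      map_zero' := by simp
      map_add' := fun s t => by simp only [Prod.fst_add, Prod.snd_add]; ring }
  let M : Multiset (ℕ × ℕ × ℕ) := (1, 0, 0) ::ₘ (0, 1, 0) ::ₘ R.map fun r => (0, 0, r)
  have hM (u v : ℕ) : M.map (ev u v) = u ::ₘ v ::ₘ R := by simp [M, ev]
  obtain ⟨⟨p, q, c⟩, hs, hψ⟩ := ReachIn.exists_symbolic_sum (ev x y) k M U (by rwa [hM])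
  replace hs : p * x + q * y + c = U.sum := hs
  rcases le_total q p with hpq | hpq
  · obtain ⟨U', hU', hsum⟩ := hψ (ev x' y')
    replace hsum : U'.sum = p * x' + q * y' + c := hsum
    refine ⟨U', by rwa [hM] at hU', ?_⟩
    obtain ⟨r, rfl⟩ := Nat.exists_eq_add_of_le hpq
    nlinarith [Nat.mul_le_mul_left r hx, Nat.mul_le_mul_left q hxy]
  · obtain ⟨U', hU', hsum⟩ := hψ (ev y' x')
    replace hsum : U'.sum = p * y' + q * x' + c := hsum
    refine ⟨U', by rwa [hM, Multiset.cons_swap] at hU', ?_⟩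
    obtain ⟨r, rfl⟩ := Nat.exists_eq_add_of_le hpq
    nlinarith [Nat.mul_le_mul_left r hy, Nat.mul_le_mul_left p hxy]

/-- `GreedyFirst k` says that for a sequence of `k + 1` moves, nothing is lost by starting with
a greedy move. -/
def GreedyFirst (k : ℕ) : Prop :=
  ∀ (a b : ℕ) (R U : Multiset ℕ), (∀ x ∈ R, a ≤ x) → (∀ x ∈ R, b ≤ x) →
    ReachIn (k + 1) (a ::ₘ b ::ₘ R) U →
      ∃ U', ReachIn k ((a + b) ::ₘ (a + b) ::ₘ R) U' ∧ U'.sum ≤ U.sum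

theorem Multiset.exists_eq_cons_forall_le {R : Multiset ℕ} (hR : R ≠ 0) :
    ∃ d R', R = d ::ₘ R' ∧ ∀ x ∈ R', d ≤ x := by
  obtain ⟨d, hd, hmin⟩ := R.toFinset.exists_min_image id (by simpa using hR)
  obtain ⟨R', rfl⟩ := Multiset.exists_cons_of_mem (Multiset.mem_toFinset.1 hd)
  exact ⟨d, R', rfl, fun x hx => hmin x (by simp [hx])⟩

theorem GreedyFirst.exchange {k : ℕ} (hk : GreedyFirst k) {a b e : ℕ} {R U : Multiset ℕ}
    (hbe : b ≤ e) (haR : ∀ x ∈ R, a ≤ x) (hbR : ∀ x ∈ R, b ≤ x)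
    (h : ReachIn (k + 1) ((a + e) ::ₘ (a + e) ::ₘ b ::ₘ R) U) :
    ∃ U', ReachIn (k + 1) ((a + b) ::ₘ (a + b) ::ₘ e ::ₘ R) U' ∧ U'.sum ≤ U.sum := by
  by_cases hmin : ∀ x ∈ R, a + e ≤ x
  · have hperm : (a + e) ::ₘ (a + e) ::ₘ b ::ₘ R = b ::ₘ (a + e) ::ₘ (a + e) ::ₘ R := by
      rw [Multiset.cons_swap (a + e) b, Multiset.cons_swap (a + e) b]
    rw [hperm] at h
    obtain ⟨U₁, h₁, hle₁⟩ := hk b (a + e) ((a + e) ::ₘ R) U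
      (by simp only [Multiset.mem_cons, forall_eq_or_imp]; exact ⟨by omega, hbR⟩)
      (by simp only [Multiset.mem_cons, forall_eq_or_imp]; exact ⟨le_rfl, hmin⟩) h
    rw [Multiset.cons_swap _ (a + e), Multiset.cons_swap _ (a + e)] at h₁
    obtain ⟨U₂, h₂, hle₂⟩ := h₁.exists_sum_le_of_spread (x' := a + b) (y' := a + b + e)
      (by omega) (by omega) (by omega)
    refine ⟨U₂, ?_, hle₂.trans hle₁⟩
    have hsum : b + (a + e) = a + b + e := by ring
    rw [hsum, Multiset.cons_swap, Multiset.cons_swap (a + b)] at h₂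
    rw [Multiset.cons_swap (a + b) e, Multiset.cons_swap (a + b) e, Multiset.cons_swap e]
    exact h₂.succ
  · push Not at hmin
    obtain ⟨x, hx, hxlt⟩ := hmin
    obtain ⟨d, R, rfl, hd⟩ := Multiset.exists_eq_cons_forall_le (R := R)
      (by rintro rfl; simp at hx)
    have hdx : d ≤ x := by
      rcases Multiset.mem_cons.1 hx with rfl | hx
      exacts [le_rfl, hd x hx]
    simp only [Multiset.mem_cons, forall_eq_or_imp] at haR hbR
    have hperm : (a + e) ::ₘ (a + e) ::ₘ b ::ₘ d ::ₘ R =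
        b ::ₘ d ::ₘ (a + e) ::ₘ (a + e) ::ₘ R := by
      simp only [← Multiset.singleton_add]; abel
    rw [hperm] at h
    obtain ⟨U₁, h₁, hle₁⟩ := hk b d ((a + e) ::ₘ (a + e) ::ₘ R) U
      (by simp only [Multiset.mem_cons, forall_eq_or_imp]; exact ⟨by omega, by omega, hbR.2⟩)
      (by simp only [Multiset.mem_cons, forall_eq_or_imp]; exact ⟨by omega, by omega, hd⟩) h
    have hperm₁ : (b + d) ::ₘ (b + d) ::ₘ (a + e) ::ₘ (a + e) ::ₘ R =
        (b + d) ::ₘ (a + e) ::ₘ (b + d) ::ₘ (a + e) ::ₘ R := by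
      simp only [← Multiset.singleton_add]; abel
    rw [hperm₁] at h₁
    obtain ⟨U₂, h₂, hle₂⟩ := h₁.exists_sum_le_of_spread (x' := a + b) (y' := e + d)
      (by omega) (by omega) (by omega)
    have hperm₂ : (a + b) ::ₘ (e + d) ::ₘ (b + d) ::ₘ (a + e) ::ₘ R =
        (b + d) ::ₘ (a + e) ::ₘ (a + b) ::ₘ (e + d) ::ₘ R := by
      simp only [← Multiset.singleton_add]; abel
    rw [hperm₂] at h₂
    obtain ⟨U₃, h₃, hle₃⟩ := h₂.exists_sum_le_of_spread (x' := a + b) (y' := e + d)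
      (by omega) (by omega) (by omega)
    refine ⟨U₃, ?_, hle₃.trans (hle₂.trans hle₁)⟩
    have hperm₃ : (a + b) ::ₘ (e + d) ::ₘ (a + b) ::ₘ (e + d) ::ₘ R =
        (e + d) ::ₘ (e + d) ::ₘ (a + b) ::ₘ (a + b) ::ₘ R := by
      simp only [← Multiset.singleton_add]; abel
    rw [hperm₃] at h₃
    have hperm₄ : (a + b) ::ₘ (a + b) ::ₘ e ::ₘ d ::ₘ R =
        e ::ₘ d ::ₘ (a + b) ::ₘ (a + b) ::ₘ R := by
      simp only [← Multiset.singleton_add]; abel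
    rw [hperm₄]
    exact h₃.succ

theorem Multiset.cons_cons_eq_cons_cons_cases {a b c d : ℕ} {R W : Multiset ℕ}
    (h : a ::ₘ b ::ₘ R = c ::ₘ d ::ₘ W) :
    (W = R ∧ c + d = a + b) ∨ (∃ e R', R = e ::ₘ R' ∧ W = b ::ₘ R' ∧ c + d = a + e) ∨
      (∃ e R', R = e ::ₘ R' ∧ W = a ::ₘ R' ∧ c + d = b + e) ∨
      ∃ R', R = c ::ₘ d ::ₘ R' ∧ W = a ::ₘ b ::ₘ R' := by
  rcases Multiset.cons_eq_cons.1 h with ⟨rfl, h'⟩ | ⟨-, X, h₁, h₂⟩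
  · rcases Multiset.cons_eq_cons.1 h' with ⟨rfl, rfl⟩ | ⟨-, Y, rfl, rfl⟩
    · exact .inl ⟨rfl, rfl⟩
    · exact .inr (.inl ⟨d, Y, rfl, rfl, rfl⟩)
  · rcases Multiset.cons_eq_cons.1 h₁ with ⟨rfl, rfl⟩ | ⟨-, Y, rfl, rfl⟩
    · rcases Multiset.cons_eq_cons.1 h₂ with ⟨rfl, rfl⟩ | ⟨-, Z, rfl, rfl⟩
      · exact .inl ⟨rfl, add_comm _ _⟩
      · exact .inr (.inr (.inl ⟨d, Z, rfl, rfl, rfl⟩))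
    · rw [Multiset.cons_swap] at h₂
      rcases Multiset.cons_eq_cons.1 h₂ with ⟨rfl, rfl⟩ | ⟨-, Z, hZ, hY⟩
      · exact .inr (.inr (.inl ⟨c, Y, rfl, rfl, add_comm _ _⟩))
      · rcases Multiset.cons_eq_cons.1 hY with ⟨rfl, rfl⟩ | ⟨-, Q, rfl, rfl⟩
        · exact .inr (.inl ⟨c, Y, rfl, hZ, add_comm _ _⟩)
        · exact .inr (.inr (.inr ⟨Q, rfl, hZ.trans (Multiset.cons_swap _ _ _)⟩))

theorem greedyFirst (k : ℕ) : GreedyFirst k := by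
  induction k with
  | zero =>
    rintro a b R U ha hb ⟨_, ⟨c, d, W, hS, rfl⟩, rfl⟩
    refine ⟨_, rfl, ?_⟩
    have hsum := congrArg Multiset.sum hS
    rcases Multiset.cons_cons_eq_cons_cons_cases hS with
      ⟨rfl, h⟩ | ⟨e, R, rfl, rfl, h⟩ | ⟨e, R, rfl, rfl, h⟩ | ⟨R, rfl, rfl⟩ <;>
    simp only [Multiset.mem_cons, forall_eq_or_imp, Multiset.sum_cons] at * <;> omega
  | succ k ih =>
    rintro a b R U ha hb ⟨_, ⟨c, d, W, hS, rfl⟩, hU⟩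
    rcases Multiset.cons_cons_eq_cons_cons_cases hS with
      ⟨rfl, h⟩ | ⟨e, R, rfl, rfl, h⟩ | ⟨e, R, rfl, rfl, h⟩ | ⟨R, rfl, rfl⟩
    · exact ⟨U, h ▸ hU, le_rfl⟩
    · rw [h] at hU
      simp only [Multiset.mem_cons, forall_eq_or_imp] at ha hb
      exact ih.exchange hb.1 ha.2 hb.2 hU
    · rw [h] at hU
      simp only [Multiset.mem_cons, forall_eq_or_imp] at ha hb
      rw [add_comm a b]
      exact ih.exchange ha.1 hb.2 ha.2 hU
    · simp only [Multiset.mem_cons, forall_eq_or_imp] at ha hb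
      have hperm : (c + d) ::ₘ (c + d) ::ₘ a ::ₘ b ::ₘ R =
          a ::ₘ b ::ₘ (c + d) ::ₘ (c + d) ::ₘ R := by
        simp only [← Multiset.singleton_add]; abel
      rw [hperm] at hU
      obtain ⟨U', hU', hle⟩ := ih a b _ U
        (by simp only [Multiset.mem_cons, forall_eq_or_imp]; exact ⟨by omega, by omega, ha.2.2⟩)
        (by simp only [Multiset.mem_cons, forall_eq_or_imp]; exact ⟨by omega, by omega, hb.2.2⟩)
        hU
      refine ⟨U', ?_, hle⟩
      have hperm₁ : (a + b) ::ₘ (a + b) ::ₘ (c + d) ::ₘ (c + d) ::ₘ R =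
          (c + d) ::ₘ (c + d) ::ₘ (a + b) ::ₘ (a + b) ::ₘ R := by
        simp only [← Multiset.singleton_add]; abel
      have hperm₂ : (a + b) ::ₘ (a + b) ::ₘ c ::ₘ d ::ₘ R =
          c ::ₘ d ::ₘ (a + b) ::ₘ (a + b) ::ₘ R := by
        simp only [← Multiset.singleton_add]; abel
      rw [hperm₁] at hU'
      rw [hperm₂]
      exact hU'.succ

theorem GreedyReachIn.reachIn {k : ℕ} :
    ∀ {S T : Multiset ℕ}, GreedyReachIn k S T → ReachIn k S T := by
  induction k with
  | zero => exact fun h => h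
  | succ k ih =>
    rintro S T ⟨V, ⟨a, b, R, rfl, -, -, rfl⟩, hV⟩
    exact (ih hV).succ

theorem GreedyReachIn.sum_le {k : ℕ} :
    ∀ {S T U : Multiset ℕ}, GreedyReachIn k S T → ReachIn k S U → T.sum ≤ U.sum := by
  induction k with
  | zero => rintro S T U rfl rfl; exact le_rfl
  | succ k ih =>
    rintro S T U ⟨V, ⟨a, b, R, rfl, ha, hb, rfl⟩, hV⟩ hU
    obtain ⟨U', hU', hle⟩ := greedyFirst k a b R U ha hb hU
    exact (ih hV hU').trans hle

/-- **The greedy strategy is optimal.**  For any starting configuration `S` of positive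
integers and any `k ≥ 0`, if one performs `k` moves each combining two smallest elements
of the current configuration, then the sum of the resulting configuration is `opt S k`. -/
theorem greedy_is_optimal (S : Multiset ℕ) (hS : ∀ x ∈ S, 0 < x) (k : ℕ)
    (T : Multiset ℕ) (hT : GreedyReachIn k S T) :
    T.sum = opt S k := by
  have hleast : IsLeast {s : ℕ | ∃ T : Multiset ℕ, ReachIn k S T ∧ T.sum = s} T.sum := by
    refine ⟨⟨T, hT.reachIn, rfl⟩, ?_⟩
    rintro _ ⟨U, hU, rfl⟩
    exact hT.sum_le hU
  exact hleast.csInf_eq.symm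
end

section
/- Let k ≥ 2 and let the starting configuration be S = {a, b, c, x₁, x₂, …, x_m} with a ≤ b ≤ c. Let U = {b+c, a+b+c, a+b+c, x₁, …, x_m} (the configuration after moves (b,c) then (a,b+c)), V = {a+c, a+b+c, a+b+c, x₁, …, x_m} (after moves (a,c) then (b,a+c)), and T = {a+b, a+b+c, a+b+c, x₁, …, x_m} (after moves (a,b) then (c,a+b)). If opt(U, k−2) = opt(S,k) or opt(V, k−2) = opt(S,k), then opt(T, k−2) = opt(S,k). -/
theorem GameMove.exists_rel_le {S S' T : Multiset ℕ} (h : GameMove S T)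
    (hr : Multiset.Rel (· ≤ ·) S' S) :
    ∃ T', GameMove S' T' ∧ Multiset.Rel (· ≤ ·) T' T := by
  obtain ⟨a, b, R, rfl, rfl⟩ := h
  obtain ⟨a', A, ha, hA, rfl⟩ := Multiset.rel_cons_right.1 hr
  obtain ⟨b', B, hb, hB, rfl⟩ := Multiset.rel_cons_right.1 hA
  exact ⟨_, ⟨a', b', B, rfl, rfl⟩, .cons (add_le_add ha hb) (.cons (add_le_add ha hb) hB)⟩

theorem ReachIn.exists_rel_le {k : ℕ} {S S' T : Multiset ℕ} (h : ReachIn k S T)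
    (hr : Multiset.Rel (· ≤ ·) S' S) :
    ∃ T', ReachIn k S' T' ∧ Multiset.Rel (· ≤ ·) T' T := by
  induction k generalizing S S' with
  | zero => cases h; exact ⟨S', rfl, hr⟩
  | succ k ih =>
    obtain ⟨U, hU, hT⟩ := h
    obtain ⟨U', hU', hr'⟩ := hU.exists_rel_le hr
    obtain ⟨T', hT', hr''⟩ := ih hT hr'
    exact ⟨T', ⟨U', hU', hT'⟩, hr''⟩

theorem exists_reachIn (k x y : ℕ) (S : Multiset ℕ) :
    ∃ T, ReachIn k (x ::ₘ y ::ₘ S) T := by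
  induction k generalizing x y with
  | zero => exact ⟨_, rfl⟩
  | succ k ih =>
    obtain ⟨T, hT⟩ := ih (x + y) (x + y)
    exact ⟨T, _, ⟨x, y, S, rfl, rfl⟩, hT⟩

theorem opt_le_sum {k : ℕ} {S T : Multiset ℕ} (h : ReachIn k S T) : opt S k ≤ T.sum :=
  Nat.sInf_le ⟨T, h, rfl⟩

theorem exists_reachIn_sum_eq_opt (k x y : ℕ) (S : Multiset ℕ) :
    ∃ T, ReachIn k (x ::ₘ y ::ₘ S) T ∧ T.sum = opt (x ::ₘ y ::ₘ S) k := by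
  obtain ⟨T, hT⟩ := exists_reachIn k x y S
  exact Nat.sInf_mem
    (s := {s : ℕ | ∃ T : Multiset ℕ, ReachIn k (x ::ₘ y ::ₘ S) T ∧ T.sum = s}) ⟨_, T, hT, rfl⟩

theorem opt_cons_le_opt_cons {x x' : ℕ} (hx : x' ≤ x) (k y : ℕ) (S : Multiset ℕ) :
    opt (x' ::ₘ y ::ₘ S) k ≤ opt (x ::ₘ y ::ₘ S) k := by
  obtain ⟨T, hT, hsum⟩ := exists_reachIn_sum_eq_opt k x y S
  obtain ⟨T', hT', hr⟩ :=
    hT.exists_rel_le (.cons hx (Multiset.rel_refl_of_refl_on fun z _ => le_refl z))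
  exact (opt_le_sum hT').trans (hsum ▸ Multiset.sum_le_sum_of_rel_le hr)

theorem opt_le_opt_two_moves (k a b c : ℕ) (X : Multiset ℕ) :
    opt (a ::ₘ b ::ₘ c ::ₘ X) (k + 2)
      ≤ opt ((a + b) ::ₘ (a + b + c) ::ₘ (a + b + c) ::ₘ X) k := by
  obtain ⟨T, hT, hsum⟩ :=
    exists_reachIn_sum_eq_opt k (a + b) (a + b + c) ((a + b + c) ::ₘ X)
  rw [← hsum]
  refine opt_le_sum ⟨_, ⟨a, b, c ::ₘ X, rfl, rfl⟩, _, ⟨a + b, c, (a + b) ::ₘ X, ?_, rfl⟩, ?_⟩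
  · rw [Multiset.cons_swap (a + b) c]
  · rwa [Multiset.cons_swap (a + b + c) (a + b), Multiset.cons_swap (a + b + c) (a + b)]

/-- Let `k ≥ 2` and let the starting configuration be `S = {a, b, c, x₁, …, x_m}` with
`0 < a ≤ b ≤ c`.  Consider the configurations after two moves:
`U = {b+c, a+b+c, a+b+c, x₁, …, x_m}` (moves `(b,c)` then `(a,b+c)`),
`V = {a+c, a+b+c, a+b+c, x₁, …, x_m}` (moves `(a,c)` then `(b,a+c)`), and
`T = {a+b, a+b+c, a+b+c, x₁, …, x_m}` (moves `(a,b)` then `(c,a+b)`).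
If starting with the moves leading to `U` or to `V` is optimal, then so is starting with
the moves leading to `T`. -/
theorem optimal_first_two_moves_three_smallest (k : ℕ) (hk : 2 ≤ k)
    (a b c : ℕ) (X : Multiset ℕ)
    (ha : 0 < a) (hab : a ≤ b) (hbc : b ≤ c) (hX : ∀ x ∈ X, 0 < x)
    (h : opt ((b + c) ::ₘ (a + b + c) ::ₘ (a + b + c) ::ₘ X) (k - 2)
            = opt (a ::ₘ b ::ₘ c ::ₘ X) k ∨
         opt ((a + c) ::ₘ (a + b + c) ::ₘ (a + b + c) ::ₘ X) (k - 2)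
            = opt (a ::ₘ b ::ₘ c ::ₘ X) k) :
    opt ((a + b) ::ₘ (a + b + c) ::ₘ (a + b + c) ::ₘ X) (k - 2)
        = opt (a ::ₘ b ::ₘ c ::ₘ X) k := by
  obtain ⟨j, rfl⟩ := Nat.exists_eq_add_of_le' hk
  rw [Nat.add_sub_cancel] at h ⊢
  refine le_antisymm ?_ (opt_le_opt_two_moves j a b c X)
  rcases h with h | h <;> rw [← h] <;> exact opt_cons_le_opt_cons (by lia) _ _ _
end

section
/- Let S = {s₁, …, s_n} and T = {t₁, …, t_n} be multisets of positive integers with s_i ≤ t_i for all 1 ≤ i ≤ n. Then opt(S,k) ≤ opt(T,k) for every integer k ≥ 0. -/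
/-- A move on the right-hand configuration can be imitated on the left-hand one, for any
elementwise relation compatible with addition. -/
theorem GameMove.exists_rel {r : ℕ → ℕ → Prop}
    (hr : ∀ a b c d, r a c → r b d → r (a + b) (c + d)) {S T V : Multiset ℕ}
    (h : Multiset.Rel r S T) (hV : GameMove T V) :
    ∃ U, GameMove S U ∧ Multiset.Rel r U V := by
  obtain ⟨c, d, T', rfl, rfl⟩ := hV
  obtain ⟨a, S₁, hac, h₁, rfl⟩ := Multiset.rel_cons_right.mp h
  obtain ⟨b, S', hbd, h', rfl⟩ := Multiset.rel_cons_right.mp h₁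
  have hsum := hr a b c d hac hbd
  exact ⟨_, ⟨a, b, S', rfl, rfl⟩, (h'.cons hsum).cons hsum⟩

/-- A sequence of moves on the right-hand configuration can be imitated on the left-hand one,
for any elementwise relation compatible with addition. -/
theorem ReachIn.exists_rel {r : ℕ → ℕ → Prop}
    (hr : ∀ a b c d, r a c → r b d → r (a + b) (c + d)) {k : ℕ} {S T V : Multiset ℕ}
    (h : Multiset.Rel r S T) (hV : ReachIn k T V) :
    ∃ U, ReachIn k S U ∧ Multiset.Rel r U V := by
  induction k generalizing S T with
  | zero =>
    obtain rfl : V = T := hV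
    exact ⟨S, rfl, h⟩
  | succ k ih =>
    obtain ⟨T₁, hT₁, hV⟩ := hV
    obtain ⟨S₁, hS₁, h₁⟩ := hT₁.exists_rel hr h
    obtain ⟨U, hU, hUV⟩ := ih h₁ hV
    exact ⟨U, ⟨S₁, hS₁, hU⟩, hUV⟩

/-- If `S = {s₁, …, s_n}` and `T = {t₁, …, t_n}` are multisets of positive integers
whose elements can be matched up so that `sᵢ ≤ tᵢ` for all `i` (expressed via
`Multiset.Rel (· ≤ ·)`), then `opt S k ≤ opt T k` for every `k ≥ 0`. -/
theorem opt_mono_of_rel_le (S T : Multiset ℕ)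
    (hS : ∀ x ∈ S, 0 < x) (hT : ∀ x ∈ T, 0 < x)
    (hST : Multiset.Rel (· ≤ ·) S T) (k : ℕ) :
    opt S k ≤ opt T k := by
  rcases Set.eq_empty_or_nonempty {s : ℕ | ∃ V, ReachIn k T V ∧ V.sum = s} with hempty | hne
  · have hSempty : {s : ℕ | ∃ U, ReachIn k S U ∧ U.sum = s} = ∅ := by
      refine Set.eq_empty_of_forall_notMem ?_
      rintro _ ⟨U, hU, -⟩
      obtain ⟨V, hV, -⟩ := hU.exists_rel (r := flip (· ≤ ·))
        (fun _ _ _ _ h₁ h₂ => Nat.add_le_add h₁ h₂) (Multiset.rel_flip.mpr hST)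
      exact Set.eq_empty_iff_forall_notMem.mp hempty _ ⟨V, hV, rfl⟩
    simp only [opt, hSempty, hempty, le_refl]
  · obtain ⟨V, hV, hsum⟩ := Nat.sInf_mem hne
    obtain ⟨U, hU, hUV⟩ := hV.exists_rel (fun _ _ _ _ h₁ h₂ => Nat.add_le_add h₁ h₂) hST
    calc opt S k ≤ U.sum := Nat.sInf_le ⟨U, hU, rfl⟩
      _ ≤ V.sum := Multiset.sum_le_sum_of_rel_le hUV
      _ = opt T k := hsum
end

section
/- Let G be a finite simple graph with an edge-labelling φ : E(G) → ℝ. If there exists a self-intersecting nice walk, i.e., a nice t-walk v₀v₁…v_t with v_i = v_j for some 0 ≤ i < j ≤ t, then φ is not a good edge-labelling. -/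
/-- A *nice walk* in `G` (with edge-labelling `φ`), recorded as its (nonempty) list of
vertices `v₀ v₁ … v_t`: consecutive vertices are adjacent, there is no immediate
backtracking (`v_{i-1} ≠ v_{i+1}`), and the labels of consecutive edges are
nondecreasing (`φ(v_{i-1}v_i) ≤ φ(v_i v_{i+1})`).  A single vertex is a nice `0`-walk. -/
def IsNiceWalk {V : Type*} (G : SimpleGraph V) (φ : Sym2 V → ℝ) (p : List V) : Prop :=
  p ≠ [] ∧ p.Chain' G.Adj ∧
    ∀ (i : ℕ) (h : i + 2 < p.length),
      p[i] ≠ p[i + 2] ∧ φ s(p[i], p[i + 1]) ≤ φ s(p[i + 1], p[i + 2])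

theorem IsNiceWalk.of_infix {V : Type*} {G : SimpleGraph V} {φ : Sym2 V → ℝ} {m p : List V}
    (hp : IsNiceWalk G φ p) (hm : m ≠ []) (hmp : m <:+: p) : IsNiceWalk G φ m := by
  refine ⟨hm, hp.2.1.infix hmp, fun i hi ↦ ?_⟩
  obtain ⟨l, r, rfl⟩ := hmp
  have get (j : ℕ) (hj : j < m.length) :
      (l ++ m ++ r)[l.length + j]'(by simp; omega) = m[j] := by
    simp [List.append_assoc, hj]
  have key := hp.2.2 (l.length + i) (by simp; omega)
  simpa only [add_assoc, get i (by omega), get (i + 1) (by omega), get (i + 2) hi] using key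

/-- A nice walk, given as a list of vertices, is the support of a walk with nondecreasing
edge labels. -/
theorem IsNiceWalk.exists_walk {V : Type*} {G : SimpleGraph V} {φ : Sym2 V → ℝ} {u : V}
    {l : List V} (h : IsNiceWalk G φ (u :: l)) :
    ∃ (v : V) (q : G.Walk u v), q.support = u :: l ∧ (q.edges.map φ).IsChain (· ≤ ·) := by
  induction l generalizing u with
  | nil => exact ⟨u, .nil, by simp⟩
  | cons w l ih =>
    obtain ⟨v, q, hq, hchain⟩ :=
      ih (h.of_infix (List.cons_ne_nil _ _) (List.suffix_cons u _).isInfix)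
    refine ⟨v, .cons (List.isChain_cons_cons.1 h.2.1).1 q, by simp [hq], ?_⟩
    cases q with
    | nil => simp
    | cons hadj q =>
      obtain ⟨r, hr⟩ : ∃ r, l = _ :: r :=
        ⟨q.support.tail, by rw [q.cons_tail_support]; simpa using hq.symm⟩
      subst hr
      have hle := (h.2.2 0 (by simp)).2
      simp only [SimpleGraph.Walk.edges_cons, List.map_cons, List.isChain_cons_cons] at hchain ⊢
      exact ⟨by simpa using hle, hchain⟩

/-- A list with a repeated entry contains a closed segment with no other repetition. -/
theorem List.exists_infix_of_not_nodup {α : Type*} {p : List α} (hp : ¬ p.Nodup) :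
    ∃ (x : α) (s : List α), (x :: s).Nodup ∧ x :: (s ++ [x]) <:+: p := by
  induction p with
  | nil => simp at hp
  | cons a l ih =>
    by_cases hl : l.Nodup
    · have ha : a ∈ l := by simpa [hl] using hp
      obtain ⟨s, r, rfl, has⟩ := List.eq_append_cons_of_mem ha
      exact ⟨a, s, List.nodup_cons.2 ⟨has, hl.of_append_left⟩, [], r, by simp⟩
    · obtain ⟨x, s, hs, hsl⟩ := ih hl
      exact ⟨x, s, hs, hsl.trans (List.suffix_cons a l).isInfix⟩

/-- If there exists a self-intersecting nice walk (a nice walk visiting some vertex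
twice), then the edge-labelling is not good. -/
theorem not_goodLabelling_of_selfIntersecting_niceWalk {V : Type*} [Fintype V]
    (G : SimpleGraph V) (φ : Sym2 V → ℝ) (p : List V)
    (hp : IsNiceWalk G φ p) (hself : ¬ p.Nodup) :
    ¬ GoodLabelling G φ := by
  intro hgood
  obtain ⟨x, s, hs, hsp⟩ := List.exists_infix_of_not_nodup hself
  have hnice := hp.of_infix (List.cons_ne_nil _ _) hsp
  obtain ⟨y, q, hq, hchain⟩ := (hnice.of_infix (List.cons_ne_nil x s)
    (List.prefix_append (x :: s) [x]).isInfix).exists_walk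
  have hy : (x :: s).getLast (List.cons_ne_nil _ _) = y := by
    simp [← hq]
  -- The last edge of the closed segment joins `y` back to `x`.
  have hyx : G.Adj y x := by
    have : (x :: (s ++ [x])).IsChain G.Adj := hnice.2.1
    rw [← List.cons_append, List.isChain_append] at this
    exact this.2.2 y (by simp [← hy, List.getLast?_eq_some_getLast]) x (by simp)
  have heq := hgood x y q (.cons hyx.symm .nil) (.mk' (hq ▸ hs))
    (by simp [hyx.ne']) hchain (List.isChain_singleton _)
  have hs' : s = [y] := by simpa [hq] using congrArg SimpleGraph.Walk.support heq
  subst hs'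
  exact (hnice.2.2 0 (by simp)).1 (by simp)
end

section
/- For every integer k ≥ 0, f(2^k) = k·2^(k−1); that is, if n is a power of two then f(n) = (n/2)·log₂(n). -/
open scoped symmDiff

namespace SimpleGraph.Walk

variable {V : Type*} {G : SimpleGraph V}

/-- A walk along which the edge labels are nondecreasing. -/
def IsNondecreasing (φ : Sym2 V → ℝ) {u v : V} (p : G.Walk u v) : Prop :=
  (p.edges.map φ).IsChain (· ≤ ·)

theorem IsNondecreasing.concat {φ : Sym2 V → ℝ} {u v w : V} {p : G.Walk u v}
    (hp : p.IsNondecreasing φ) (h : G.Adj v w) (hmax : ∀ e ∈ p.edges, φ e ≤ φ s(v, w)) :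
    (p.concat h).IsNondecreasing φ := by
  unfold IsNondecreasing at hp ⊢
  rw [edges_concat, List.concat_eq_append, List.map_append, List.isChain_append]
  refine ⟨hp, List.isChain_singleton _, fun x hx y hy => ?_⟩
  obtain ⟨e, he, rfl⟩ := List.mem_map.1 (List.mem_of_mem_getLast? hx)
  obtain rfl : φ s(v, w) = y := by simpa using hy
  exact hmax e he

theorem IsNondecreasing.dropUntil [DecidableEq V] {φ : Sym2 V → ℝ} {u v w : V} {p : G.Walk u v}
    (hp : p.IsNondecreasing φ) (h : w ∈ p.support) : (p.dropUntil w h).IsNondecreasing φ :=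
  List.IsChain.suffix hp ((p.edges_dropUntil_suffix_edges h).map φ)

theorem IsNondecreasing.of_cons {φ : Sym2 V → ℝ} {u v w : V} {h : G.Adj u v} {p : G.Walk v w}
    (hp : (cons h p).IsNondecreasing φ) : p.IsNondecreasing φ := by
  unfold IsNondecreasing at hp ⊢
  rw [edges_cons, List.map_cons] at hp
  exact hp.tail

theorem IsNondecreasing.le_of_cons {φ : Sym2 V → ℝ} {u v w : V} {h : G.Adj u v} {p : G.Walk v w}
    (hp : (cons h p).IsNondecreasing φ) : ∀ e ∈ p.edges, φ s(u, v) ≤ φ e := by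
  unfold IsNondecreasing at hp
  rw [edges_cons, List.map_cons, List.isChain_iff_pairwise, List.pairwise_cons] at hp
  exact fun e he => hp.1 _ (List.mem_map_of_mem he)

end SimpleGraph.Walk

section UpperBound

variable {V : Type*} {G : SimpleGraph V} {φ : Sym2 V → ℝ}

open SimpleGraph

/-- In a good labelling, a nondecreasing path to `u` that avoids the edge `uv` but whose labels are
at most that of `uv` cannot visit `v`. -/
theorem GoodLabelling.notMem_support (hφ : GoodLabelling G φ) {u v w : V} (h : G.Adj u v)
    {p : G.Walk w u} (hp : p.IsPath) (hinc : p.IsNondecreasing φ) (he : s(u, v) ∉ p.edges) :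
    v ∉ p.support := by
  classical
  intro hv
  have heq := hφ v u (p.dropUntil v hv) h.symm.toWalk (hp.dropUntil hv)
    (by simpa using h.ne') (hinc.dropUntil hv) (List.isChain_singleton _)
  apply he
  apply p.edges_dropUntil_subset_edges hv
  rw [heq]
  simp [Sym2.eq_swap]

/-- In a good labelling, no vertex reaches both ends of an edge `uv` by nondecreasing paths that
avoid `uv` and whose labels are at most that of `uv`. -/
theorem GoodLabelling.false_of_paths (hφ : GoodLabelling G φ) {u v w : V} (h : G.Adj u v)
    {p : G.Walk w u} (hp : p.IsPath) (hpinc : p.IsNondecreasing φ)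
    (hpe : s(u, v) ∉ p.edges) (hple : ∀ e ∈ p.edges, φ e ≤ φ s(u, v))
    {q : G.Walk w v} (hq : q.IsPath) (hqinc : q.IsNondecreasing φ)
    (hqe : s(u, v) ∉ q.edges) : False := by
  have heq := hφ w v (p.concat h) q (hp.concat (hφ.notMem_support h hp hpinc hpe) h) hq
    (hpinc.concat h hple) hqinc
  apply hqe
  simp [← heq, Walk.edges_concat]

/-- `w` is joined to `v` by a nondecreasing path of `G` with all edges in `S`. -/
def NondecreasingReach (G : SimpleGraph V) (φ : Sym2 V → ℝ) (S : Finset (Sym2 V)) (w v : V) :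
    Prop :=
  ∃ p : G.Walk w v, p.IsPath ∧ p.IsNondecreasing φ ∧ ∀ e ∈ p.edges, e ∈ S

theorem NondecreasingReach.mono {S T : Finset (Sym2 V)} (hST : S ⊆ T) {w v : V}
    (h : NondecreasingReach G φ S w v) : NondecreasingReach G φ T w v :=
  let ⟨p, hp, hinc, hS⟩ := h
  ⟨p, hp, hinc, fun e he => hST (hS e he)⟩

theorem GoodLabelling.nondecreasingReach_insert [DecidableEq V] (hφ : GoodLabelling G φ)
    {S : Finset (Sym2 V)} {u v w : V} (h : G.Adj u v) (hS : s(u, v) ∉ S)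
    (hmax : ∀ e ∈ S, φ e ≤ φ s(u, v)) (hw : NondecreasingReach G φ S w u) :
    NondecreasingReach G φ (insert s(u, v) S) w v := by
  obtain ⟨p, hp, hinc, hpS⟩ := hw
  refine ⟨p.concat h, hp.concat (hφ.notMem_support h hp hinc fun he => hS (hpS _ he)) h,
    hinc.concat h fun e he => hmax e (hpS e he), fun e he => ?_⟩
  rw [Walk.edges_concat, List.concat_eq_append, List.mem_append, List.mem_singleton] at he
  rcases he with he | rfl
  · exact Finset.mem_insert_of_mem (hpS e he)
  · exact Finset.mem_insert_self _ _

theorem four_mul_prod_le_prod_ite [Fintype V] [DecidableEq V] (f : V → ℕ) {u v : V} (huv : u ≠ v) :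
    4 * ∏ x, f x ≤ ∏ x, if x = u ∨ x = v then f u + f v else f x := by
  have hv : v ∈ Finset.univ.erase u := by simp [huv.symm]
  rw [← Finset.mul_prod_erase _ f (Finset.mem_univ u), ← Finset.mul_prod_erase _ f hv,
    ← Finset.mul_prod_erase _ _ (Finset.mem_univ u), ← Finset.mul_prod_erase _ _ hv,
    Finset.prod_congr rfl (g := f) (s₁ := (Finset.univ.erase u).erase v)
      (f := fun x => if x = u ∨ x = v then f u + f v else f x)
      fun x hx => by simp_all]
  simp only [true_or, or_true, if_true, ← mul_assoc]
  refine Nat.mul_le_mul_right _ ?_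
  zify
  nlinarith [sq_nonneg ((f u : ℤ) - f v)]

theorem GoodLabelling.exists_sets_four_pow_le [Fintype V] [DecidableEq V]
    (hφ : GoodLabelling G φ) (S : Finset (Sym2 V)) :
    (∀ e ∈ S, e ∈ G.edgeSet) → ∃ R : V → Finset V,
      (∀ v, ∀ w ∈ R v, NondecreasingReach G φ S w v) ∧ 4 ^ S.card ≤ ∏ v, (R v).card := by
  induction S using Finset.induction_on_max_value φ with
  | empty =>
    refine fun _ => ⟨fun v => {v}, fun v w hw => ?_, by simp⟩
    obtain rfl := Finset.mem_singleton.1 hw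
    exact ⟨Walk.nil, Walk.IsPath.nil, List.isChain_nil, by simp⟩
  | insert e S he hmax ih =>
    intro hS
    obtain ⟨R, hR, hcard⟩ := ih fun x hx => hS x (Finset.mem_insert_of_mem hx)
    have hadj := hS e (Finset.mem_insert_self _ _)
    induction e with | _ u v =>
    rw [mem_edgeSet] at hadj
    have hdisj : Disjoint (R u) (R v) := by
      rw [Finset.disjoint_left]
      intro w hwu hwv
      obtain ⟨p, hp, hpinc, hpS⟩ := hR u w hwu
      obtain ⟨q, hq, hqinc, hqS⟩ := hR v w hwv
      exact hφ.false_of_paths hadj hp hpinc (fun h => he (hpS _ h))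
        (fun e h => hmax e (hpS e h)) hq hqinc fun h => he (hqS _ h)
    refine ⟨fun x => if x = u ∨ x = v then R u ∪ R v else R x, fun x w hw => ?_, ?_⟩
    · dsimp only at hw
      split_ifs at hw with hx
      · rcases hx with rfl | rfl <;> rcases Finset.mem_union.1 hw with hw | hw
        · exact (hR _ _ hw).mono (Finset.subset_insert _ _)
        · rw [Sym2.eq_swap] at he hmax ⊢
          exact hφ.nondecreasingReach_insert hadj.symm he hmax (hR _ _ hw)
        · exact hφ.nondecreasingReach_insert hadj he hmax (hR _ _ hw)
        · exact (hR _ _ hw).mono (Finset.subset_insert _ _)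
      · exact (hR _ _ hw).mono (Finset.subset_insert _ _)
    · rw [Finset.card_insert_of_notMem he, pow_succ']
      refine (Nat.mul_le_mul_left 4 hcard).trans
        ((four_mul_prod_le_prod_ite (fun x => (R x).card) hadj.ne).trans_eq ?_)
      refine Finset.prod_congr rfl fun x _ => ?_
      dsimp only
      rw [apply_ite Finset.card, Finset.card_union_of_disjoint hdisj]

theorem IsGoodGraph.four_pow_ncard_edgeSet_le [Fintype V] (hG : IsGoodGraph G) :
    4 ^ G.edgeSet.ncard ≤ Fintype.card V ^ Fintype.card V := by
  classical
  obtain ⟨φ, hφ⟩ := hG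
  obtain ⟨R, -, hcard⟩ := hφ.exists_sets_four_pow_le G.edgeFinset fun e he => mem_edgeFinset.1 he
  rw [Set.ncard_eq_toFinset_card', Set.toFinset_card, card_edgeSet]
  exact hcard.trans ((Finset.prod_le_pow_card _ _ _ fun v _ => Finset.card_le_univ (R v)).trans_eq
    (by rw [Finset.card_univ]))

end UpperBound

section Hypercube

variable {V : Type*} {k : ℕ} (σ : V ≃ Finset (Fin k))

open SimpleGraph

/-- The hypercube graph on a vertex set identified with the subsets of `Fin k`: two vertices are
adjacent when the subsets differ in exactly one element. -/
def hypercube : SimpleGraph V where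
  Adj a b := ∃ i, σ a ∆ σ b = {i}
  symm := ⟨fun a b ⟨i, h⟩ => ⟨i, by rw [symmDiff_comm, h]⟩⟩
  loopless := ⟨fun a ⟨i, h⟩ => by simp at h⟩

/-- The label of an edge of the hypercube is the coordinate in which its ends differ. -/
def hypercubeLabel (e : Sym2 V) : ℝ :=
  Sym2.lift ⟨fun a b => ∑ i ∈ σ a ∆ σ b, (i : ℝ), fun a b => by simp only [symmDiff_comm]⟩ e

variable {σ}

theorem hypercubeLabel_mk {a b : V} {i : Fin k} (h : σ a ∆ σ b = {i}) :
    hypercubeLabel σ s(a, b) = i := by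
  simp [hypercubeLabel, h]

theorem eq_of_symmDiff_eq {a b c : V} {i : Fin k} (hb : σ a ∆ σ b = {i})
    (hc : σ a ∆ σ c = {i}) : b = c :=
  σ.injective (symmDiff_right_injective (σ a) (hb.trans hc.symm))

theorem le_of_mem_symmDiff {u v : V} (p : (hypercube σ).Walk u v) {j : Fin k}
    (hp : ∀ e ∈ p.edges, (j : ℝ) ≤ hypercubeLabel σ e) : ∀ i ∈ σ u ∆ σ v, j ≤ i := by
  induction p with
  | nil => simp
  | @cons u w v h p ih =>
    intro i hi
    obtain ⟨l, hl⟩ := id h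
    have hjl := hp s(u, w) (by simp)
    rw [hypercubeLabel_mk hl] at hjl
    rcases Finset.mem_union.1 (symmDiff_triangle (σ u) (σ w) (σ v) hi) with hi | hi
    · rw [hl, Finset.mem_singleton] at hi
      subst hi
      exact_mod_cast hjl
    · exact ih (fun e he => hp e (by simp [he])) i hi

/-- The first coordinate changed by a nondecreasing path of the hypercube is the least one in
which its ends differ. -/
theorem isLeast_of_nondecreasing {u w v : V} {i : Fin k} (h : (hypercube σ).Adj u w)
    (hi : σ u ∆ σ w = {i}) (p : (hypercube σ).Walk w v) (hp : (Walk.cons h p).IsPath)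
    (hinc : (Walk.cons h p).IsNondecreasing (hypercubeLabel σ)) :
    IsLeast (σ u ∆ σ v : Set (Fin k)) i := by
  have hle := hinc.le_of_cons
  rw [hypercubeLabel_mk hi] at hle
  have hmin := le_of_mem_symmDiff (Walk.cons h p) (j := i) (by
    rw [Walk.edges_cons]
    rintro e (_ | ⟨_, he⟩)
    · exact (hypercubeLabel_mk hi).ge
    · exact hle e he)
  refine ⟨?_, fun j hj => hmin j (by exact_mod_cast hj)⟩
  suffices hiw : i ∉ σ w ∆ σ v by
    have hmem : i ∈ σ u ∆ σ w := by simp [hi]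
    have : i ∈ σ u ∆ σ v := by
      simp only [Finset.mem_symmDiff] at hmem hiw ⊢
      tauto
    exact_mod_cast this
  cases p with
  | nil => simp
  | @cons _ x _ h' p =>
    obtain ⟨j, hj⟩ := id h'
    have hij := hle s(w, x) (by simp)
    rw [hypercubeLabel_mk hj] at hij
    have hne : i ≠ j := by
      rintro rfl
      rw [symmDiff_comm] at hi
      obtain rfl := eq_of_symmDiff_eq hi hj
      simp [Walk.cons_isPath_iff] at hp
    intro hmem
    have hlej := hinc.of_cons.le_of_cons
    rw [hypercubeLabel_mk hj] at hlej
    have hji := le_of_mem_symmDiff (Walk.cons h' p) (j := j) (by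
      rw [Walk.edges_cons]
      rintro e (_ | ⟨_, he⟩)
      · exact (hypercubeLabel_mk hj).ge
      · exact hlej e he) i hmem
    exact hne (le_antisymm (by exact_mod_cast hij) hji)

theorem goodLabelling_hypercube : GoodLabelling (hypercube σ) (hypercubeLabel σ) := by
  intro u v p
  induction p with
  | nil =>
    intro q _ hq _ _
    exact (Walk.isPath_iff_nil.1 hq).eq_nil.symm
  | @cons u w v h p ih =>
    intro q hp hq hpinc hqinc
    cases q with
    | nil => simp at hp
    | @cons _ w' _ h' q =>
      obtain ⟨i, hi⟩ := id h
      obtain ⟨j, hj⟩ := id h'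
      obtain rfl := (isLeast_of_nondecreasing h hi p hp hpinc).unique
        (isLeast_of_nondecreasing h' hj q hq hqinc)
      obtain rfl := eq_of_symmDiff_eq hi hj
      rw [ih q hp.of_cons hq.of_cons (Walk.IsNondecreasing.of_cons hpinc)
        (Walk.IsNondecreasing.of_cons hqinc)]

theorem two_mul_ncard_edgeSet_hypercube [Fintype V] :
    2 * (hypercube σ).edgeSet.ncard = Fintype.card V * k := by
  classical
  rw [Set.ncard_eq_toFinset_card', Set.toFinset_card, card_edgeSet,
    ← sum_degrees_eq_twice_card_edges, Finset.sum_const_nat (m := k), Finset.card_univ]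
  intro a _
  have hinj : Function.Injective fun i : Fin k => σ.symm (σ a ∆ {i}) := fun i j hij =>
    Finset.singleton_injective (symmDiff_right_injective _ (σ.symm.injective hij))
  have : (hypercube σ).neighborFinset a =
      Finset.univ.image fun i : Fin k => σ.symm (σ a ∆ {i}) := by
    ext b
    simp only [mem_neighborFinset, Finset.mem_image, Finset.mem_univ, true_and]
    refine exists_congr fun i => ?_
    rw [Equiv.symm_apply_eq]
    constructor
    · intro h
      rw [← h, symmDiff_symmDiff_cancel_left]
    · intro h
      rw [← h, symmDiff_symmDiff_cancel_left]
  rw [← card_neighborFinset_eq_degree, this, Finset.card_image_of_injective _ hinj,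
    Finset.card_univ, Fintype.card_fin]

end Hypercube

/-- If `n = 2^k` is a power of two, then `f(n) = (n/2)·log₂ n`, i.e.
`f(2^k) = k · 2^(k-1)` for every `k ≥ 0`. -/
theorem goodMax_pow_two (k : ℕ) : goodMax (2 ^ k) = k * 2 ^ (k - 1) := by
  obtain ⟨σ⟩ : Nonempty (Fin (2 ^ k) ≃ Finset (Fin k)) := ⟨Fintype.equivOfCardEq (by simp)⟩
  have hpow : 2 * (k * 2 ^ (k - 1)) = 2 ^ k * k := by
    cases k with
    | zero => rfl
    | succ k => rw [Nat.add_sub_cancel]; ring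
  refine IsGreatest.csSup_eq ⟨⟨hypercube σ, ⟨_, goodLabelling_hypercube⟩, ?_⟩, ?_⟩
  · have h := two_mul_ncard_edgeSet_hypercube (σ := σ)
    rw [Fintype.card_fin, ← hpow] at h
    exact Nat.eq_of_mul_eq_mul_left two_pos h
  · rintro m ⟨G, hG, rfl⟩
    have h := hG.four_pow_ncard_edgeSet_le
    rw [Fintype.card_fin, ← pow_mul, mul_comm k, ← hpow, pow_mul] at h
    exact (Nat.pow_le_pow_iff_right (by norm_num)).1 h
end

section
/- Let G be a finite simple graph with m edges and an edge-labelling φ assigning m pairwise distinct real labels, and enumerate the edges as e₁, …, e_m with φ(e₁) < φ(e₂) < … < φ(e_m). For 0 ≤ i ≤ m let G_i be the subgraph with the same vertex set and edge set {e₁, …, e_i}, and for each vertex w let a_w^(i) be the number of nice walks in G_i whose last vertex is w. Then a_w^(0) = 1 for every vertex w, and for each 1 ≤ i ≤ m, if e_i = uv then a_u^(i) = a_v^(i) = a_u^(i−1) + a_v^(i−1), and a_w^(i) = a_w^(i−1) for every vertex w ∉ {u, v}. -/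
section NiceWalk

variable {V : Type*} {G H : SimpleGraph V} {φ : Sym2 V → ℝ}

theorem isNiceWalk_singleton (G : SimpleGraph V) (φ : Sym2 V → ℝ) (w : V) :
    IsNiceWalk G φ [w] :=
  ⟨by simp, List.isChain_singleton w, fun i h => by simp at h⟩

theorem isNiceWalk_concat_concat (r : List V) (y w : V) :
    IsNiceWalk G φ (r ++ [y] ++ [w]) ↔
      IsNiceWalk G φ (r ++ [y]) ∧ G.Adj y w ∧
        ∀ x ∈ r.getLast?, x ≠ w ∧ φ s(x, y) ≤ φ s(y, w) := by
  have hchain : (r ++ [y] ++ [w]).IsChain G.Adj ↔ (r ++ [y]).IsChain G.Adj ∧ G.Adj y w := by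
    rw [List.isChain_append]
    simp
  have hget : ∀ j (hj : j < (r ++ [y]).length),
      (r ++ [y] ++ [w])[j]'(by simp at hj ⊢; omega) = (r ++ [y])[j] :=
    fun j hj => List.getElem_append_left hj
  unfold IsNiceWalk
  constructor
  · rintro ⟨-, hc, h⟩
    obtain ⟨hc, hyw⟩ := hchain.1 hc
    refine ⟨⟨by simp, hc, fun i hi => ?_⟩, hyw, fun x hx => ?_⟩
    · have := h i (by simp at hi ⊢; omega)
      rwa [hget i (by omega), hget (i + 1) (by omega), hget (i + 2) (by omega)] at this
    · rcases List.eq_nil_or_concat r with rfl | ⟨t, z, rfl⟩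
      · simp at hx
      obtain rfl : z = x := by simpa using hx
      have := h t.length (by simp)
      simpa [List.getElem_append_right] using this
  · rintro ⟨⟨-, hc, h⟩, hyw, hx⟩
    refine ⟨by simp, hchain.2 ⟨hc, hyw⟩, fun i hi => ?_⟩
    by_cases hlt : i + 2 < (r ++ [y]).length
    · have := h i hlt
      rwa [hget i (by omega), hget (i + 1) (by omega), hget (i + 2) (by omega)]
    · rcases List.eq_nil_or_concat r with rfl | ⟨t, x, rfl⟩
      · simp at hi
      · obtain rfl : i = t.length := by simp at hi hlt; omega
        have := hx x (by simp)
        simpa [List.getElem_append_right] using this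

theorem IsNiceWalk.adj_of_mem_getLast? {r : List V} {x w : V}
    (h : IsNiceWalk G φ (r ++ [w])) (hx : x ∈ r.getLast?) : G.Adj x w := by
  rcases List.eq_nil_or_concat r with rfl | ⟨t, y, rfl⟩
  · simp at hx
  · obtain rfl : y = x := by simpa using hx
    rw [List.concat_eq_append] at h
    exact ((isNiceWalk_concat_concat t y w).1 h).2.1

/-- If `H` arises from `G` by adding an edge `f` whose label exceeds all labels of `G`, then a
nice walk in `H` is a nice walk in `G`, possibly followed by a traversal of `f`. -/
theorem isNiceWalk_concat_iff_of_add_edge {f : Sym2 V}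
    (hlt : ∀ x y, G.Adj x y → φ s(x, y) < φ f)
    (hH : ∀ x y, H.Adj x y ↔ G.Adj x y ∨ s(x, y) = f) (r : List V) (w : V) :
    IsNiceWalk H φ (r ++ [w]) ↔
      IsNiceWalk G φ (r ++ [w]) ∨ (IsNiceWalk G φ r ∧ ∃ x ∈ r.getLast?, s(x, w) = f) := by
  induction r using List.reverseRecOn generalizing w with
  | nil => simp [isNiceWalk_singleton]
  | append_singleton r y ih =>
    rw [isNiceWalk_concat_concat, isNiceWalk_concat_concat, ih, hH]
    simp only [List.getLast?_concat, Option.mem_some_iff, exists_eq_left']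
    constructor
    · rintro ⟨h | ⟨-, z, hz, hzy⟩, hyw | hyw, hx⟩
      · exact Or.inl ⟨h, hyw, hx⟩
      · exact Or.inr ⟨h, hyw⟩
      · have h1 := (hx z hz).2
        rw [hzy] at h1
        exact absurd (hlt y w hyw) h1.not_gt
      · refine absurd ?_ (hx z hz).1
        rw [← hyw, Sym2.eq_swap] at hzy
        exact Sym2.congr_right.1 hzy
    · rintro (⟨h, hyw, hx⟩ | ⟨h, hyw⟩)
      · exact ⟨Or.inl h, Or.inl hyw, hx⟩
      · refine ⟨Or.inl h, Or.inr hyw, fun x hx => ?_⟩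
        have hxy := hlt x y (h.adj_of_mem_getLast? hx)
        rw [hyw]
        refine ⟨?_, hxy.le⟩
        rintro rfl
        rw [Sym2.eq_swap, hyw] at hxy
        exact lt_irrefl _ hxy

/-- The nice walks whose last vertex is `w`. -/
def niceWalksTo (G : SimpleGraph V) (φ : Sym2 V → ℝ) (w : V) : Set (List V) :=
  {p | IsNiceWalk G φ p ∧ p.getLast? = some w}

theorem mem_niceWalksTo_iff {p : List V} {w : V} :
    p ∈ niceWalksTo G φ w ↔ ∃ r, p = r ++ [w] ∧ IsNiceWalk G φ (r ++ [w]) := by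
  constructor
  · rintro ⟨h, hw⟩
    rcases List.eq_nil_or_concat p with rfl | ⟨t, y, rfl⟩
    · simp at hw
    · obtain rfl : y = w := by simpa using hw
      rw [List.concat_eq_append] at h ⊢
      exact ⟨t, rfl, h⟩
  · rintro ⟨r, rfl, h⟩
    exact ⟨h, by simp⟩

theorem niceWalksTo_bot (φ : Sym2 V → ℝ) (w : V) : niceWalksTo ⊥ φ w = {[w]} := by
  ext p
  rw [mem_niceWalksTo_iff, Set.mem_singleton_iff]
  constructor
  · rintro ⟨r, rfl, h⟩
    rcases List.eq_nil_or_concat r with rfl | ⟨t, y, rfl⟩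
    · rfl
    · exact absurd (h.adj_of_mem_getLast? (x := y) (by simp)) (by simp)
  · rintro rfl
    exact ⟨[], rfl, isNiceWalk_singleton _ _ _⟩

theorem niceWalksTo_left_of_add_edge {u v : V}
    (hlt : ∀ x y, G.Adj x y → φ s(x, y) < φ s(u, v))
    (hH : ∀ x y, H.Adj x y ↔ G.Adj x y ∨ s(x, y) = s(u, v)) :
    niceWalksTo H φ u = niceWalksTo G φ u ∪ (· ++ [u]) '' niceWalksTo G φ v := by
  ext p
  simp only [Set.mem_union, Set.mem_image]
  rw [mem_niceWalksTo_iff, mem_niceWalksTo_iff]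
  simp only [isNiceWalk_concat_iff_of_add_edge hlt hH]
  constructor
  · rintro ⟨r, rfl, h | ⟨h, x, hx, hxu⟩⟩
    · exact Or.inl ⟨r, rfl, h⟩
    · rw [Sym2.eq_swap] at hxu
      obtain rfl := Sym2.congr_right.1 hxu
      exact Or.inr ⟨r, ⟨h, hx⟩, rfl⟩
  · rintro (⟨r, rfl, h⟩ | ⟨r, ⟨h, hv⟩, rfl⟩)
    · exact ⟨r, rfl, Or.inl h⟩
    · exact ⟨r, rfl, Or.inr ⟨h, v, hv, Sym2.eq_swap⟩⟩

theorem niceWalksTo_of_ne_of_add_edge {u v w : V}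
    (hlt : ∀ x y, G.Adj x y → φ s(x, y) < φ s(u, v))
    (hH : ∀ x y, H.Adj x y ↔ G.Adj x y ∨ s(x, y) = s(u, v)) (hwu : w ≠ u) (hwv : w ≠ v) :
    niceWalksTo H φ w = niceWalksTo G φ w := by
  ext p
  rw [mem_niceWalksTo_iff, mem_niceWalksTo_iff]
  simp only [isNiceWalk_concat_iff_of_add_edge hlt hH]
  refine exists_congr fun r => and_congr_right fun _ => or_iff_left ?_
  rintro ⟨-, x, -, hx⟩
  have : w ∈ s(u, v) := hx ▸ Sym2.mem_mk_right x w
  simp [hwu, hwv] at this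

theorem ncard_niceWalksTo_left_of_add_edge {u v : V}
    (hlt : ∀ x y, G.Adj x y → φ s(x, y) < φ s(u, v))
    (hH : ∀ x y, H.Adj x y ↔ G.Adj x y ∨ s(x, y) = s(u, v))
    (hu : (niceWalksTo G φ u).Finite) (hv : (niceWalksTo G φ v).Finite) :
    (niceWalksTo H φ u).ncard = (niceWalksTo G φ u).ncard + (niceWalksTo G φ v).ncard := by
  rw [niceWalksTo_left_of_add_edge hlt hH, Set.ncard_union_eq ?_ hu (hv.image _),
    Set.ncard_image_of_injective _ (List.append_left_injective [u])]
  rw [Set.disjoint_left]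
  rintro _ ⟨h, -⟩ ⟨r, ⟨-, hr⟩, rfl⟩
  have := hlt _ _ (h.adj_of_mem_getLast? hr)
  rw [Sym2.eq_swap] at this
  exact lt_irrefl _ this

theorem finite_niceWalksTo_of_add_edge {u v : V}
    (hlt : ∀ x y, G.Adj x y → φ s(x, y) < φ s(u, v))
    (hH : ∀ x y, H.Adj x y ↔ G.Adj x y ∨ s(x, y) = s(u, v))
    (hfin : ∀ w, (niceWalksTo G φ w).Finite) (w : V) : (niceWalksTo H φ w).Finite := by
  by_cases hwu : w = u
  · subst hwu
    rw [niceWalksTo_left_of_add_edge hlt hH]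
    exact (hfin _).union ((hfin _).image _)
  by_cases hwv : w = v
  · subst hwv
    rw [Sym2.eq_swap] at hlt hH
    rw [niceWalksTo_left_of_add_edge hlt hH]
    exact (hfin _).union ((hfin _).image _)
  · rw [niceWalksTo_of_ne_of_add_edge hlt hH hwu hwv]
    exact hfin w

end NiceWalk

/-- Let `G` be a finite simple graph whose `m` edges are enumerated as `e 0, …, e (m-1)`
with strictly increasing (hence pairwise distinct) labels under `φ`.  For `0 ≤ i ≤ m`,
let `Gs i` be the subgraph of `G` (on the same vertex set) whose edges are
`e 0, …, e (i-1)`, and for each vertex `w` let `a i w` be the number of nice walks in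
`Gs i` whose last vertex is `w`.  Then `a 0 w = 1` for every vertex `w`, and for every
`1 ≤ i ≤ m`, if `e (i-1) = {u, v}`, then
`a i u = a i v = a (i-1) u + a (i-1) v`, while `a i w = a (i-1) w` for `w ∉ {u, v}`. -/
theorem niceWalk_count_recurrence {V : Type*} [Fintype V] (G : SimpleGraph V)
    (φ : Sym2 V → ℝ) (m : ℕ) (e : Fin m → Sym2 V)
    (he : G.edgeSet = Set.range e)
    (hmono : ∀ i j : Fin m, i < j → φ (e i) < φ (e j))
    (Gs : ℕ → SimpleGraph V)
    (hGs : ∀ i : ℕ, Gs i = SimpleGraph.fromEdgeSet {x | ∃ j : Fin m, (j : ℕ) < i ∧ x = e j})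
    (a : ℕ → V → ℕ)
    (ha : ∀ (i : ℕ) (w : V),
      a i w = Set.ncard {p : List V | IsNiceWalk (Gs i) φ p ∧ p.getLast? = some w}) :
    (∀ w : V, a 0 w = 1) ∧
      ∀ (i : Fin m) (u v : V), e i = s(u, v) →
        a ((i : ℕ) + 1) u = a (i : ℕ) u + a (i : ℕ) v ∧
        a ((i : ℕ) + 1) v = a (i : ℕ) u + a (i : ℕ) v ∧
        ∀ w : V, w ≠ u → w ≠ v → a ((i : ℕ) + 1) w = a (i : ℕ) w := by
  have hloop : ∀ j, ¬ (e j).IsDiag := fun j =>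
    G.not_isDiag_of_mem_edgeSet (he ▸ Set.mem_range_self j)
  have hadj : ∀ i x y, (Gs i).Adj x y ↔ ∃ j : Fin m, (j : ℕ) < i ∧ s(x, y) = e j := by
    intro i x y
    rw [hGs, SimpleGraph.fromEdgeSet_adj]
    refine and_iff_left_of_imp ?_
    rintro ⟨j, -, hj⟩ rfl
    exact hloop j (hj ▸ rfl)
  have hlt : ∀ (i : Fin m) u v, e i = s(u, v) →
      ∀ x y, (Gs i).Adj x y → φ s(x, y) < φ s(u, v) := by
    intro i u v hi x y hxy
    obtain ⟨j, hj, hxy⟩ := (hadj _ _ _).1 hxy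
    rw [hxy, ← hi]
    exact hmono j i hj
  have hsucc : ∀ (i : Fin m) u v, e i = s(u, v) →
      ∀ x y, (Gs (i + 1)).Adj x y ↔ (Gs i).Adj x y ∨ s(x, y) = s(u, v) := by
    intro i u v hi x y
    rw [hadj, hadj, ← hi]
    constructor
    · rintro ⟨j, hj, hxy⟩
      rcases (Nat.lt_succ_iff_lt_or_eq).1 hj with hj | hj
      · exact Or.inl ⟨j, hj, hxy⟩
      · exact Or.inr (Fin.ext hj ▸ hxy)
    · rintro (⟨j, hj, hxy⟩ | hxy)
      · exact ⟨j, hj.trans (Nat.lt_succ_self _), hxy⟩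
      · exact ⟨i, Nat.lt_succ_self _, hxy⟩
  have hzero : Gs 0 = ⊥ := by
    ext x y
    simp [hadj]
  have hfin : ∀ i ≤ m, ∀ w, (niceWalksTo (Gs i) φ w).Finite := by
    intro i
    induction i with
    | zero =>
      intro _ w
      rw [hzero, niceWalksTo_bot]
      exact Set.finite_singleton _
    | succ i ih =>
      intro hi
      obtain ⟨⟨u, v⟩, huv⟩ := Sym2.mk_surjective (e ⟨i, hi⟩)
      exact finite_niceWalksTo_of_add_edge (hlt ⟨i, hi⟩ u v huv.symm)
        (hsucc ⟨i, hi⟩ u v huv.symm) (ih (by omega))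
  have ha' : ∀ i w, a i w = (niceWalksTo (Gs i) φ w).ncard := ha
  simp only [ha']
  refine ⟨fun w => by rw [hzero, niceWalksTo_bot, Set.ncard_singleton],
    fun i u v hi => ⟨?_, ?_, fun w hwu hwv => ?_⟩⟩
  · exact ncard_niceWalksTo_left_of_add_edge (hlt i u v hi) (hsucc i u v hi)
      (hfin i i.2.le u) (hfin i i.2.le v)
  · rw [Sym2.eq_swap] at hi
    rw [add_comm (Set.ncard _)]
    exact ncard_niceWalksTo_left_of_add_edge (hlt i v u hi) (hsucc i v u hi)
      (hfin i i.2.le v) (hfin i i.2.le u)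
  · rw [niceWalksTo_of_ne_of_add_edge (hlt i u v hi) (hsucc i u v hi) hwu hwv]
end
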